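/- arXiv:1510.09148 — 2 statements merged into one kernel-verified Lean document; each statement's English description precedes it below -/
import Mathlib

section
/- Let α > −1/4, g ∈ L₁(ℝ), and suppose (G_α g)(x) ∈ L_{ν,1}((0,1)) for some ν with max(−α, 0) < ν < 1/2. Then for all y > 0, (1/2πi) ∫_{ν−i∞}^{ν+i∞} [Γ(s)Γ(1+α−s)/Γ(s+α)] (G_α g)*(s) y^{−s} ds = √π ∫_{−∞}^∞ e^{y/2} K_{iτ}(y/2) g(τ)/cosh(πτ) dτ, where (G_α g)* denotes the Mellin transform of G_α g. -/
/-- Modified Bessel function of the second kind (Macdonald function). -/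
noncomputable def besselK (ν : ℂ) (x : ℝ) : ℂ :=
  ∫ t in Set.Ioi (0 : ℝ), Complex.exp (-(x : ℂ) * Real.cosh t) * Complex.cosh (ν * t)

/-- Modified Bessel function of the first kind. -/
noncomputable def besselI (ν : ℂ) (x : ℝ) : ℂ :=
  ∑' k : ℕ, ((x : ℂ) / 2) ^ (ν + 2 * (k : ℂ)) / ((Nat.factorial k : ℂ) * Complex.Gamma (ν + (k : ℂ) + 1))

/-- The index transform `G_α`. -/
noncomputable def Gtrans (α : ℝ) (g : ℝ → ℝ) (x : ℝ) : ℝ :=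
  2 * Real.sqrt Real.pi *
    ∫ τ : ℝ, (besselK (α + τ * Complex.I) (Real.sqrt x) *
      besselI (α - τ * Complex.I) (Real.sqrt x)).re * g τ / Real.cosh (Real.pi * τ)

/-- The Mellin transform `f*(s) = ∫_0^∞ f(x) x^{s−1} dx`. -/
noncomputable def mellinT (f : ℝ → ℝ) (s : ℂ) : ℂ :=
  ∫ x in Set.Ioi (0 : ℝ), (f x : ℂ) * (x : ℂ) ^ (s - 1)

section
open MeasureTheory Set Filter ComplexConjugate

lemma norm_Gamma_le_Gamma_re {z : ℂ} (hz : 0 < z.re) : ‖Complex.Gamma z‖ ≤ Real.Gamma z.re := by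
  rw [Complex.Gamma_eq_integral hz, Real.Gamma_eq_integral hz, Complex.GammaIntegral]
  refine (norm_integral_le_integral_norm _).trans (le_of_eq ?_)
  refine setIntegral_congr_fun measurableSet_Ioi fun x hx => ?_
  simp only [norm_mul, Complex.norm_real, Complex.norm_cpow_eq_rpow_re_of_pos hx]
  simp [abs_of_pos (Real.exp_pos _)]

lemma integrableOn_cpow_mul_exp_neg_mul {a : ℂ} {r : ℝ} (ha : 0 < a.re) (hr : 0 < r) :
    IntegrableOn (fun t : ℝ => (t : ℂ) ^ (a - 1) * Complex.exp (-(r * t))) (Ioi 0) := by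
  have h := (Complex.GammaIntegral_convergent ha)
  have h2 := (integrableOn_Ioi_comp_mul_left_iff
    (fun t : ℝ => ((Real.exp (-t) : ℝ) : ℂ) * (t : ℂ) ^ (a - 1)) 0 hr).2 (by simpa using h)
  have h3 := h2.const_mul ((r : ℂ) ^ (1 - a))
  refine IntegrableOn.congr_fun h3 (fun t ht => ?_) measurableSet_Ioi
  have ht' : (0:ℝ) < t := ht
  have hr0 : (r : ℂ) ≠ 0 := by exact_mod_cast hr.ne'
  push_cast
  rw [Complex.mul_cpow_ofReal_nonneg hr.le ht'.le, show (1 - a) = -(a - 1) by ring,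
    Complex.cpow_neg]
  have : (r : ℂ) ^ (a - 1) ≠ 0 := by simp [Complex.cpow_eq_zero_iff, hr0]
  field_simp

lemma integrableOn_rpow_mul_exp_neg_mul {a r : ℝ} (ha : 0 < a) (hr : 0 < r) :
    IntegrableOn (fun t : ℝ => t ^ (a - 1) * Real.exp (-(r * t))) (Ioi 0) := by
  have := (integrableOn_cpow_mul_exp_neg_mul (a := a) (by simpa using ha) hr).norm
  refine IntegrableOn.congr_fun this (fun t ht => ?_) measurableSet_Ioi
  have ht' : (0:ℝ) < t := ht
  simp only [norm_mul, Complex.norm_cpow_eq_rpow_re_of_pos ht', Complex.norm_exp]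
  simp

lemma hasSum_Gamma_add_nat_mul_pow {a : ℂ} (ha : 0 < a.re) {u : ℝ} (hu0 : 0 ≤ u) (hu1 : u < 1) :
    HasSum (fun k : ℕ => Complex.Gamma (a + k) / (k.factorial : ℂ) * (u : ℂ) ^ k)
      (Complex.Gamma a * ((1 - u : ℝ) : ℂ) ^ (-a)) := by
  have h1u : 0 < 1 - u := by linarith
  have key := hasSum_integral_of_dominated_convergence (μ := volume.restrict (Ioi (0 : ℝ)))
    (F := fun (k : ℕ) (t : ℝ) => (t : ℂ) ^ (a - 1) * Complex.exp (-t) *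
      (((u * t) ^ k / (k.factorial : ℝ) : ℝ) : ℂ))
    (f := fun t : ℝ => (t : ℂ) ^ (a - 1) * Complex.exp (-(((1 - u : ℝ) : ℂ) * t)))
    (bound := fun k t => t ^ (a.re - 1) * Real.exp (-t) * ((u * t) ^ k / (k.factorial : ℝ)))
    ?_ ?_ ?_ ?_ ?_
  · rw [Complex.integral_cpow_mul_exp_neg_mul_Ioi ha (by simpa using h1u)] at key
    have e2 : (1 / ((1 - u : ℝ) : ℂ)) ^ a * Complex.Gamma a
        = Complex.Gamma a * ((1 - u : ℝ) : ℂ) ^ (-a) := by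
      rw [Complex.cpow_neg, one_div, Complex.inv_cpow, mul_comm]
      rw [Complex.arg_ofReal_of_nonneg h1u.le]; exact Real.pi_pos.ne
    rw [e2] at key
    refine key.congr_fun fun k => ?_
    symm
    have hk : 0 < (a + k).re := by simp only [Complex.add_re, Complex.natCast_re]; positivity
    have : ∀ t ∈ Ioi (0:ℝ), (t : ℂ) ^ (a - 1) * Complex.exp (-t) *
      (((u * t) ^ k / (k.factorial : ℝ) : ℝ) : ℂ) =
        ((u : ℂ) ^ k / (k.factorial : ℂ)) * ((t : ℂ) ^ (a + k - 1) * Complex.exp (-((1 : ℝ) * t))) := by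
      intro t ht
      have ht0 : (t : ℂ) ≠ 0 := by exact_mod_cast (ne_of_gt ht)
      rw [show a + k - 1 = (a - 1) + k by ring, Complex.cpow_add _ _ ht0, Complex.cpow_natCast]
      push_cast
      rw [mul_pow, one_mul]; ring
    rw [setIntegral_congr_fun measurableSet_Ioi this, integral_const_mul,
      Complex.integral_cpow_mul_exp_neg_mul_Ioi hk (by simp)]
    simp
    ring
  · intro k
    apply ContinuousOn.aestronglyMeasurable _ measurableSet_Ioi
    intro t ht
    have : (t : ℂ) ∈ Complex.slitPlane := Complex.ofReal_mem_slitPlane.2 ht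
    apply ContinuousAt.continuousWithinAt
    fun_prop (disch := assumption)
  · intro k
    filter_upwards [ae_restrict_mem measurableSet_Ioi] with t ht
    have ht' : (0:ℝ) < t := ht
    simp only [norm_mul, Complex.norm_cpow_eq_rpow_re_of_pos ht', Complex.norm_exp, Complex.norm_real]
    rw [Real.norm_of_nonneg (by positivity)]
    simp
  · filter_upwards with t
    exact (Real.summable_pow_div_factorial _).mul_left _
  · refine IntegrableOn.congr_fun (integrableOn_rpow_mul_exp_neg_mul ha h1u) (fun t ht => ?_)
      measurableSet_Ioi
    rw [tsum_mul_left, mul_assoc]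
    congr 1
    rw [show -((1 - u) * t) = -t + u * t by ring, Real.exp_add]
    congr 1
    rw [Real.exp_eq_exp_ℝ, NormedSpace.exp_eq_tsum_div]
  · filter_upwards with t
    have : Complex.exp (-(((1 - u : ℝ) : ℂ) * t)) = Complex.exp (-t) * ((Real.exp (u * t) : ℝ) : ℂ) := by
      push_cast
      rw [← Complex.exp_add]; ring_nf
    rw [this, ← mul_assoc]
    apply HasSum.mul_left
    rw [Complex.hasSum_ofReal]
    rw [Real.exp_eq_exp_ℝ]
    exact NormedSpace.expSeries_div_hasSum_exp _

lemma hasSum_real_Gamma_add_nat_mul_pow {a : ℝ} (ha : 0 < a) {u : ℝ} (hu0 : 0 ≤ u) (hu1 : u < 1) :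
    HasSum (fun k : ℕ => Real.Gamma (a + k) / (k.factorial : ℝ) * u ^ k)
      (Real.Gamma a * (1 - u) ^ (-a)) := by
  have h := hasSum_Gamma_add_nat_mul_pow (a := a) (by simpa using ha) hu0 hu1
  rw [← Complex.hasSum_ofReal]
  convert h using 1
  · ext k
    push_cast [← Complex.Gamma_ofReal]; rfl
  · rw [Complex.ofReal_mul, Complex.ofReal_cpow (by linarith), Complex.Gamma_ofReal]; simp

lemma image_exp_neg_Ioi : (fun θ : ℝ => Real.exp (-θ)) '' Ioi 0 = Ioo 0 1 := by
  ext x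
  simp only [mem_image, mem_Ioi, mem_Ioo]
  constructor
  · rintro ⟨θ, hθ, rfl⟩
    exact ⟨Real.exp_pos _, by simpa using hθ⟩
  · rintro ⟨h0, h1⟩
    exact ⟨-Real.log x, by simpa using Real.log_neg h0 h1, by simp [Real.exp_log h0]⟩

lemma hasDerivWithinAt_exp_neg (s : Set ℝ) (x : ℝ) :
    HasDerivWithinAt (fun θ : ℝ => Real.exp (-θ)) (-Real.exp (-x)) s x := by
  simpa using (hasDerivAt_neg x).exp.hasDerivWithinAt (s := s)

lemma injOn_exp_neg (s : Set ℝ) : InjOn (fun θ : ℝ => Real.exp (-θ)) s := by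
  intro x _ y _ h
  simpa using h

lemma exp_neg_smul_beta_integrand (u v : ℂ) (θ : ℝ) :
    |-Real.exp (-θ)| • (((Real.exp (-θ) : ℝ) : ℂ) ^ (u - 1) *
      (1 - ((Real.exp (-θ) : ℝ) : ℂ)) ^ (v - 1)) =
    Complex.exp (-(θ * u)) * ((1 - Real.exp (-θ) : ℝ) : ℂ) ^ (v - 1) := by
  rw [abs_neg, abs_of_pos (Real.exp_pos _), Complex.real_smul, ← mul_assoc]
  congr 1
  · rw [Complex.cpow_def_of_ne_zero (by exact_mod_cast (Real.exp_pos _).ne'), ← Complex.ofReal_log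
      (Real.exp_pos _).le, Real.log_exp, Complex.ofReal_exp, ← Complex.exp_add]
    push_cast; ring_nf
  · push_cast; rfl

lemma betaIntegral_eq_integral_Ioi (u v : ℂ) :
    Complex.betaIntegral u v = ∫ θ in Ioi (0 : ℝ),
      Complex.exp (-(θ * u)) * ((1 - Real.exp (-θ) : ℝ) : ℂ) ^ (v - 1) := by
  rw [Complex.betaIntegral, intervalIntegral.integral_of_le zero_le_one,
    integral_Ioc_eq_integral_Ioo, ← image_exp_neg_Ioi,
    integral_image_eq_integral_abs_deriv_smul measurableSet_Ioi
      (fun x _ => hasDerivWithinAt_exp_neg _ x) (injOn_exp_neg _)]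
  simp_rw [exp_neg_smul_beta_integrand]

lemma integrableOn_beta_integrand {u v : ℂ} (hu : 0 < u.re) (hv : 0 < v.re) :
    IntegrableOn (fun θ : ℝ =>
      Complex.exp (-(θ * u)) * ((1 - Real.exp (-θ) : ℝ) : ℂ) ^ (v - 1)) (Ioi 0) := by
  have h := Complex.betaIntegral_convergent hu hv
  rw [intervalIntegrable_iff_integrableOn_Ioo_of_le zero_le_one, ← image_exp_neg_Ioi,
    integrableOn_image_iff_integrableOn_abs_deriv_smul measurableSet_Ioi
      (fun x _ => hasDerivWithinAt_exp_neg _ x) (injOn_exp_neg _)] at h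
  simpa only [exp_neg_smul_beta_integrand] using h

lemma one_sub_exp_neg_pos {θ : ℝ} (hθ : 0 < θ) : 0 < 1 - Real.exp (-θ) := by
  have : Real.exp (-θ) < 1 := by simpa using hθ
  linarith

lemma norm_beta_integrand (u v : ℂ) {θ : ℝ} (hθ : 0 < θ) :
    ‖Complex.exp (-(θ * u)) * ((1 - Real.exp (-θ) : ℝ) : ℂ) ^ (v - 1)‖ =
      Real.exp (-(θ * u.re)) * (1 - Real.exp (-θ)) ^ (v.re - 1) := by
  rw [norm_mul, Complex.norm_cpow_eq_rpow_re_of_pos (one_sub_exp_neg_pos hθ), Complex.norm_exp]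
  simp

lemma integrableOn_real_beta_integrand {u v : ℝ} (hu : 0 < u) (hv : 0 < v) :
    IntegrableOn (fun θ : ℝ =>
      Real.exp (-(θ * u)) * (1 - Real.exp (-θ)) ^ (v - 1)) (Ioi 0) := by
  have h := (integrableOn_beta_integrand (u := u) (v := v) (by simpa using hu)
    (by simpa using hv)).norm
  refine IntegrableOn.congr_fun h (fun θ hθ => ?_) measurableSet_Ioi
  simpa using norm_beta_integrand u v hθ

/-- Gauss's summation of the hypergeometric series at `1`, with the beta function on the right
left in integral form. -/
lemma hasSum_Gamma_quotient {a b c : ℂ} (ha : 0 < a.re) (hb : 0 < b.re) (hcb : 0 < (c - b).re)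
    (hcab : 0 < (c - a - b).re) :
    HasSum (fun k : ℕ => Complex.Gamma (a + k) * Complex.Gamma (b + k) /
        ((k.factorial : ℂ) * Complex.Gamma (c + k)))
      (Complex.Gamma a / Complex.Gamma (c - b) * ∫ θ in Ioi (0 : ℝ),
        Complex.exp (-(θ * b)) * ((1 - Real.exp (-θ) : ℝ) : ℂ) ^ (c - a - b - 1)) := by
  have key := hasSum_integral_of_dominated_convergence (μ := volume.restrict (Ioi (0 : ℝ)))
    (F := fun (k : ℕ) (θ : ℝ) => Complex.Gamma (a + k) / (k.factorial : ℂ) *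
      (Complex.exp (-(θ * (b + k))) * ((1 - Real.exp (-θ) : ℝ) : ℂ) ^ (c - b - 1)))
    (f := fun θ : ℝ => Complex.Gamma a *
      (Complex.exp (-(θ * b)) * ((1 - Real.exp (-θ) : ℝ) : ℂ) ^ (c - a - b - 1)))
    (bound := fun k θ => (Real.exp (-(θ * b.re)) * (1 - Real.exp (-θ)) ^ ((c - b).re - 1)) *
      (Real.Gamma (a.re + k) / (k.factorial : ℝ) * (Real.exp (-θ)) ^ k))
    ?_ ?_ ?_ ?_ ?_
  · have h2 := key.mul_left (1 / Complex.Gamma (c - b))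
    rw [integral_const_mul, ← mul_assoc, one_div_mul_eq_div] at h2
    refine h2.congr_fun fun k => ?_
    have hbk : 0 < (b + k).re := by simp only [Complex.add_re, Complex.natCast_re]; positivity
    have hck : 0 < (c + k).re := by
      have : 0 ≤ (k : ℝ) := by positivity
      simp only [Complex.add_re, Complex.natCast_re, Complex.sub_re] at *; linarith
    rw [integral_const_mul, ← betaIntegral_eq_integral_Ioi, Complex.betaIntegral_eq_Gamma_mul_div
      _ _ hbk hcb, show b + k + (c - b) = c + k by ring]
    have h1 := Complex.Gamma_ne_zero_of_re_pos hcb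
    have h2 := Complex.Gamma_ne_zero_of_re_pos hck
    field_simp
  · intro k
    have hbk : 0 < (b + k).re := by simp only [Complex.add_re, Complex.natCast_re]; positivity
    exact ((integrableOn_beta_integrand hbk hcb).const_mul _).aestronglyMeasurable
  · intro k
    filter_upwards [ae_restrict_mem measurableSet_Ioi] with θ hθ
    have hak : 0 < (a + k).re := by simp only [Complex.add_re, Complex.natCast_re]; positivity
    have hpos := one_sub_exp_neg_pos hθ
    rw [norm_mul, norm_beta_integrand _ _ hθ, norm_div, Complex.norm_natCast, ← Real.exp_nat_mul]
    have e : Real.exp (-(θ * (b + k : ℂ).re)) = Real.exp (-(θ * b.re)) * Real.exp (k * -θ) := by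
      rw [← Real.exp_add]; simp; ring
    have h1 : ‖Complex.Gamma (a + k)‖ ≤ Real.Gamma (a.re + k) := by
      simpa using norm_Gamma_le_Gamma_re hak
    rw [e]
    calc _ ≤ Real.Gamma (a.re + k) / (k.factorial : ℝ) * (Real.exp (-(θ * b.re)) *
          Real.exp (k * -θ) * (1 - Real.exp (-θ)) ^ ((c - b).re - 1)) := by gcongr
      _ = _ := by ring
  · filter_upwards [ae_restrict_mem measurableSet_Ioi] with θ hθ
    have hpos := one_sub_exp_neg_pos hθ
    exact (hasSum_real_Gamma_add_nat_mul_pow ha (Real.exp_pos _).le (by linarith)).summable.mul_left _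
  · have := (integrableOn_real_beta_integrand hb hcab).const_mul (Real.Gamma a.re)
    refine IntegrableOn.congr_fun this (fun θ hθ => ?_) measurableSet_Ioi
    have hpos := one_sub_exp_neg_pos hθ
    rw [tsum_mul_left, (hasSum_real_Gamma_add_nat_mul_pow ha (Real.exp_pos _).le
      (by linarith)).tsum_eq, show (c - a - b).re - 1 = ((c - b).re - 1) + (-a.re) by
      simp; ring, Real.rpow_add hpos]
    ring
  · filter_upwards [ae_restrict_mem measurableSet_Ioi] with θ hθ
    have hpos := one_sub_exp_neg_pos hθ
    have h0 : ((1 - Real.exp (-θ) : ℝ) : ℂ) ≠ 0 := by exact_mod_cast hpos.ne'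
    have h := (hasSum_Gamma_add_nat_mul_pow ha (Real.exp_pos (-θ)).le (by linarith)).mul_left
      (Complex.exp (-(θ * b)) * ((1 - Real.exp (-θ) : ℝ) : ℂ) ^ (c - b - 1))
    have e : Complex.Gamma a *
      (Complex.exp (-(θ * b)) * ((1 - Real.exp (-θ) : ℝ) : ℂ) ^ (c - a - b - 1)) =
      (Complex.exp (-(θ * b)) * ((1 - Real.exp (-θ) : ℝ) : ℂ) ^ (c - b - 1)) *
       (Complex.Gamma a * ((1 - Real.exp (-θ) : ℝ) : ℂ) ^ (-a)) := by
      rw [show c - a - b - 1 = (c - b - 1) + (-a) by ring, Complex.cpow_add _ _ h0]; ring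
    rw [e]
    refine h.congr_fun fun k => ?_
    rw [show -((θ : ℂ) * (b + k)) = -(θ * b) + k * (-θ) by ring, Complex.exp_add, Complex.exp_nat_mul]
    push_cast
    ring

lemma image_logistic : (fun t : ℝ => Real.exp t / (2 * Real.cosh t)) '' univ = Ioo 0 1 := by
  ext x
  simp only [mem_image, mem_univ, true_and, mem_Ioo]
  have h2 (t : ℝ) : 2 * Real.cosh t = Real.exp t + Real.exp (-t) := by rw [Real.cosh_eq]; ring
  constructor
  · rintro ⟨t, rfl⟩
    rw [h2]
    refine ⟨by positivity, ?_⟩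
    rw [div_lt_one (by positivity)]
    linarith [Real.exp_pos (-t)]
  · rintro ⟨h0, h1⟩
    refine ⟨Real.log (x / (1 - x)) / 2, ?_⟩
    set t := Real.log (x / (1 - x)) / 2 with ht
    have h1' : 0 < 1 - x := by linarith
    have e : Real.exp t * Real.exp t = x / (1 - x) := by
      rw [← Real.exp_add, show t + t = Real.log (x / (1 - x)) by rw [ht]; ring,
        Real.exp_log (by positivity)]
    have e' : Real.exp (-t) * Real.exp t = 1 := by rw [← Real.exp_add]; simp
    rw [h2, div_eq_iff (by positivity)]
    apply mul_right_cancel₀ (Real.exp_pos t).ne'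
    rw [mul_assoc, add_mul, e', e]
    field_simp
    ring

lemma hasDerivWithinAt_logistic (s : Set ℝ) (t : ℝ) :
    HasDerivWithinAt (fun t : ℝ => Real.exp t / (2 * Real.cosh t))
      (2 / (2 * Real.cosh t) ^ 2) s t := by
  have h := ((Real.hasDerivAt_exp t).div ((Real.hasDerivAt_cosh t).const_mul 2)
    (by positivity [Real.cosh_pos t])).hasDerivWithinAt (s := s)
  refine h.congr_deriv ?_
  congr 1
  have e' : Real.exp (-t) * Real.exp t = 1 := by rw [← Real.exp_add]; simp
  rw [Real.cosh_eq, Real.sinh_eq]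
  linear_combination 2 * e'

lemma injOn_logistic (s : Set ℝ) : InjOn (fun t : ℝ => Real.exp t / (2 * Real.cosh t)) s := by
  intro x _ y _ h
  simp only at h
  rw [div_eq_div_iff (by positivity [Real.cosh_pos x]) (by positivity [Real.cosh_pos y]),
    Real.cosh_eq, Real.cosh_eq] at h
  have h3 : Real.exp (x - y) = Real.exp (y - x) := by
    rw [sub_eq_add_neg, sub_eq_add_neg, Real.exp_add, Real.exp_add]
    linarith
  have := Real.exp_injective h3
  linarith

lemma logistic_smul_beta_integrand (A B : ℂ) (t : ℝ) :
    |2 / (2 * Real.cosh t) ^ 2| • (((Real.exp t / (2 * Real.cosh t) : ℝ) : ℂ) ^ (A - 1) *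
      (1 - ((Real.exp t / (2 * Real.cosh t) : ℝ) : ℂ)) ^ (B - 1)) =
    2 * (((2 * Real.cosh t : ℝ) : ℂ) ^ (-(A + B)) * Complex.exp ((A - B) * t)) := by
  have hc : 0 < 2 * Real.cosh t := by positivity [Real.cosh_pos t]
  have hc0 : ((2 * Real.cosh t : ℝ) : ℂ) ≠ 0 := by exact_mod_cast hc.ne'
  have e1 : (1 - ((Real.exp t / (2 * Real.cosh t) : ℝ) : ℂ)) =
      ((Real.exp (-t) / (2 * Real.cosh t) : ℝ) : ℂ) := by
    rw [← Complex.ofReal_one, ← Complex.ofReal_sub]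
    congr 1
    rw [eq_div_iff hc.ne', sub_mul, div_mul_cancel₀ _ hc.ne', Real.cosh_eq]
    ring
  have key (r : ℝ) (z : ℂ) : ((Real.exp r / (2 * Real.cosh t) : ℝ) : ℂ) ^ z =
      Complex.exp (r * z) * ((2 * Real.cosh t : ℝ) : ℂ) ^ (-z) := by
    rw [Complex.cpow_neg, Complex.ofReal_div, Complex.div_cpow_ofReal_nonneg (Real.exp_pos _).le
      hc.le, Complex.cpow_def_of_ne_zero (x := ((Real.exp r : ℝ) : ℂ))
      (by exact_mod_cast (Real.exp_pos _).ne'), ← Complex.ofReal_log (Real.exp_pos _).le,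
      Real.log_exp, div_eq_mul_inv]
  rw [e1, key, key, abs_of_pos (by positivity), Complex.real_smul]
  have e2 : ((2 * Real.cosh t : ℝ) : ℂ) ^ (-(A + B)) =
      ((2 * Real.cosh t : ℝ) : ℂ) ^ (-(A - 1)) * ((2 * Real.cosh t : ℝ) : ℂ) ^ (-(B - 1)) *
        (((2 * Real.cosh t : ℝ) : ℂ) ^ 2)⁻¹ := by
    rw [← Complex.cpow_add _ _ hc0, ← Complex.cpow_two, ← Complex.cpow_neg,
      ← Complex.cpow_add _ _ hc0]
    congr 1; ring
  have e3 : Complex.exp ((A - B) * t) = Complex.exp (t * (A - 1)) *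
      Complex.exp ((-t : ℝ) * (B - 1)) := by
    rw [← Complex.exp_add]; push_cast; ring_nf
  rw [e2, e3]
  push_cast
  ring

lemma integrable_two_cosh_cpow_mul_exp {w μ : ℂ} (h : |μ.re| < 2 * w.re) :
    Integrable (fun t : ℝ => ((2 * Real.cosh t : ℝ) : ℂ) ^ (-(2 * w)) * Complex.exp (μ * t)) := by
  obtain ⟨h1, h2⟩ := abs_lt.1 h
  have h := Complex.betaIntegral_convergent (u := w + μ / 2) (v := w - μ / 2)
    (by simp; linarith) (by simp; linarith)
  rw [intervalIntegrable_iff_integrableOn_Ioo_of_le zero_le_one, ← image_logistic,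
    integrableOn_image_iff_integrableOn_abs_deriv_smul MeasurableSet.univ
      (fun x _ => hasDerivWithinAt_logistic _ x) (injOn_logistic _)] at h
  simp only [logistic_smul_beta_integrand, integrableOn_univ] at h
  rw [show w + μ / 2 + (w - μ / 2) = 2 * w by ring, show w + μ / 2 - (w - μ / 2) = μ by ring] at h
  refine (h.const_mul (1 / 2)).congr (ae_of_all _ fun t => ?_)
  simp only
  ring

lemma integral_two_cosh_cpow_mul_exp (w μ : ℂ) :
    ∫ t : ℝ, ((2 * Real.cosh t : ℝ) : ℂ) ^ (-(2 * w)) * Complex.exp (μ * t) =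
      1 / 2 * Complex.betaIntegral (w + μ / 2) (w - μ / 2) := by
  rw [Complex.betaIntegral, intervalIntegral.integral_of_le zero_le_one,
    integral_Ioc_eq_integral_Ioo, ← image_logistic,
    integral_image_eq_integral_abs_deriv_smul MeasurableSet.univ
      (fun x _ => hasDerivWithinAt_logistic _ x) (injOn_logistic _)]
  simp only [logistic_smul_beta_integrand, setIntegral_univ]
  rw [integral_const_mul, show w + μ / 2 + (w - μ / 2) = 2 * w by ring,
    show w + μ / 2 - (w - μ / 2) = μ by ring, ← mul_assoc]
  norm_num

lemma integral_Ioi_even_part {E : Type*} [NormedAddCommGroup E] [NormedSpace ℝ E] {f : ℝ → E}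
    (hf : Integrable f) : ∫ t in Ioi (0 : ℝ), (f t + f (-t)) = ∫ t, f t := by
  rw [integral_add hf.integrableOn hf.comp_neg.integrableOn, integral_comp_neg_Ioi, add_comm,
    neg_zero, intervalIntegral.integral_Iic_add_Ioi hf.integrableOn hf.integrableOn]

lemma cosh_cpow_mul_cosh (w μ : ℂ) (t : ℝ) :
    (Real.cosh t : ℂ) ^ (-(2 * w)) * Complex.cosh (μ * t) = 4 ^ w / 2 *
      (((2 * Real.cosh t : ℝ) : ℂ) ^ (-(2 * w)) * Complex.exp (μ * t) +
        ((2 * Real.cosh (-t) : ℝ) : ℂ) ^ (-(2 * w)) * Complex.exp (μ * (-t : ℝ))) := by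
  have h4 : (4 : ℂ) ^ w * (2 : ℂ) ^ (-(2 * w)) = 1 := by
    have h2 : (2 : ℂ) ^ w ≠ 0 := by simp [Complex.cpow_eq_zero_iff]
    rw [show (4 : ℂ) = ((2 : ℝ) : ℂ) * ((2 : ℝ) : ℂ) by norm_num,
      Complex.mul_cpow_ofReal_nonneg (by norm_num) (by norm_num), Complex.cpow_neg,
      two_mul w, Complex.cpow_add _ _ two_ne_zero]
    push_cast
    field_simp
  have e : ((2 * Real.cosh t : ℝ) : ℂ) ^ (-(2 * w)) =
      2 ^ (-(2 * w)) * (Real.cosh t : ℂ) ^ (-(2 * w)) := by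
    rw [Complex.ofReal_mul, Complex.mul_cpow_ofReal_nonneg (by norm_num) (Real.cosh_pos t).le]
    norm_num
  rw [Real.cosh_neg, e, Complex.cosh]
  push_cast
  rw [mul_neg]
  linear_combination (-(1/2) * (Complex.cosh t) ^ (-(2 * w)) *
    (Complex.exp (μ * t) + Complex.exp (-(μ * t)))) * h4

lemma integrableOn_cosh_cpow_mul_cosh {w μ : ℂ} (h : |μ.re| < 2 * w.re) :
    IntegrableOn (fun t : ℝ => (Real.cosh t : ℂ) ^ (-(2 * w)) * Complex.cosh (μ * t)) (Ioi 0) := by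
  have h1 := integrable_two_cosh_cpow_mul_exp h
  simp_rw [cosh_cpow_mul_cosh]
  exact ((h1.add h1.comp_neg).const_mul _).integrableOn

lemma integral_cosh_cpow_mul_cosh {w μ : ℂ} (h : |μ.re| < 2 * w.re) :
    ∫ t in Ioi (0 : ℝ), (Real.cosh t : ℂ) ^ (-(2 * w)) * Complex.cosh (μ * t) =
      4 ^ w / 4 * Complex.betaIntegral (w + μ / 2) (w - μ / 2) := by
  have h1 := integrable_two_cosh_cpow_mul_exp h
  simp_rw [cosh_cpow_mul_cosh]
  rw [integral_const_mul, integral_Ioi_even_part h1, integral_two_cosh_cpow_mul_exp]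
  ring

lemma sq_cpow_mul_aux {w : ℂ} {z : ℝ} (hz : 0 < z) (E : ℂ) :
    ((2 * z ^ ((2 : ℝ) - 1) : ℝ)) • (E * ((z ^ (2 : ℝ) : ℝ) : ℂ) ^ (w - 1)) =
      2 * ((z : ℂ) ^ (2 * w - 1) * E) := by
  have hz0 : (z : ℂ) ≠ 0 := by exact_mod_cast hz.ne'
  rw [show (2 : ℝ) - 1 = 1 by norm_num, Real.rpow_one, Real.rpow_two, sq, Complex.ofReal_mul,
    Complex.mul_cpow_ofReal_nonneg hz.le hz.le, Complex.real_smul, ← Complex.cpow_add _ _ hz0,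
    show 2 * w - 1 = w - 1 + (w - 1) + 1 by ring, Complex.cpow_add (w - 1 + (w - 1)) 1 hz0,
    Complex.cpow_one]
  push_cast
  ring

lemma exp_neg_sqrt_aux (c : ℝ) {z : ℝ} (hz : 0 < z) :
    Complex.exp (-((Real.sqrt (z ^ (2 : ℝ)) : ℝ) : ℂ) * c) = Complex.exp (-(c * z)) := by
  rw [Real.rpow_two, Real.sqrt_sq hz.le]; ring_nf

lemma integrableOn_exp_neg_sqrt_mul_cpow {w : ℂ} {c : ℝ} (hw : 0 < w.re) (hc : 0 < c) :
    IntegrableOn (fun x : ℝ => Complex.exp (-(Real.sqrt x : ℂ) * c) * (x : ℂ) ^ (w - 1))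
      (Ioi 0) := by
  rw [← integrableOn_Ioi_comp_rpow_iff _ (p := 2) two_ne_zero]
  have h : 0 < (2 * w).re := by simp [hw]
  refine IntegrableOn.congr_fun ((integrableOn_cpow_mul_exp_neg_mul h hc).const_mul 2)
    (fun z hz => ?_) measurableSet_Ioi
  rw [exp_neg_sqrt_aux c hz, abs_of_pos two_pos, sq_cpow_mul_aux hz]

lemma integral_exp_neg_sqrt_mul_cpow {w : ℂ} {c : ℝ} (hw : 0 < w.re) (hc : 0 < c) :
    ∫ x in Ioi (0 : ℝ), Complex.exp (-(Real.sqrt x : ℂ) * c) * (x : ℂ) ^ (w - 1) =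
      2 * Complex.Gamma (2 * w) * (c : ℂ) ^ (-(2 * w)) := by
  rw [← integral_comp_rpow_Ioi_of_pos (p := 2) two_pos]
  have h : 0 < (2 * w).re := by simp [hw]
  have e : ∀ z ∈ Ioi (0 : ℝ), ((2 * z ^ ((2 : ℝ) - 1) : ℝ)) •
      (Complex.exp (-((Real.sqrt (z ^ (2 : ℝ)) : ℝ) : ℂ) * c) *
        ((z ^ (2 : ℝ) : ℝ) : ℂ) ^ (w - 1)) =
      2 * ((z : ℂ) ^ (2 * w - 1) * Complex.exp (-(c * z))) := by
    intro z hz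
    rw [exp_neg_sqrt_aux c hz, sq_cpow_mul_aux hz]
  rw [setIntegral_congr_fun measurableSet_Ioi e, integral_const_mul,
    Complex.integral_cpow_mul_exp_neg_mul_Ioi h (by simpa using hc), one_div, Complex.inv_cpow,
    Complex.cpow_neg]
  · ring
  · rw [Complex.arg_ofReal_of_nonneg hc.le]; exact Real.pi_pos.ne

lemma integrable_besselK_kernel {w μ : ℂ} (h : |μ.re| < 2 * w.re) :
    Integrable (fun p : ℝ × ℝ => Complex.exp (-(Real.sqrt p.1 : ℂ) * Real.cosh p.2) *
      Complex.cosh (μ * p.2) * (p.1 : ℂ) ^ (w - 1))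
      ((volume.restrict (Ioi 0)).prod (volume.restrict (Ioi 0))) := by
  have hw : 0 < w.re := by linarith [abs_nonneg μ.re]
  have hm : Measurable (fun p : ℝ × ℝ => Complex.exp (-(Real.sqrt p.1 : ℂ) * Real.cosh p.2) *
      Complex.cosh (μ * p.2) * (p.1 : ℂ) ^ (w - 1)) := by
    have : Measurable Real.sqrt := Real.continuous_sqrt.measurable
    have : Measurable Real.cosh := Real.continuous_cosh.measurable
    have : Measurable Complex.cosh := Complex.continuous_cosh.measurable
    fun_prop
  rw [integrable_prod_iff' hm.aestronglyMeasurable]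
  constructor
  · filter_upwards with t
    refine ((integrableOn_exp_neg_sqrt_mul_cpow hw (Real.cosh_pos t)).mul_const
      (Complex.cosh (μ * t))).congr (ae_of_all _ fun x => ?_)
    simp only
    ring
  · have hb := (integrableOn_cosh_cpow_mul_cosh h).norm.const_mul (2 * Real.Gamma (2 * w.re))
    refine hb.congr (ae_of_all _ fun t => ?_)
    simp only
    have hwr : 0 < ((w.re : ℝ) : ℂ).re := by simpa using hw
    have hr := integral_exp_neg_sqrt_mul_cpow hwr (Real.cosh_pos t)
    have e : ∀ x ∈ Ioi (0 : ℝ), ‖Complex.exp (-(Real.sqrt x : ℂ) * Real.cosh t) *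
      Complex.cosh (μ * t) * (x : ℂ) ^ (w - 1)‖ =
        ‖Complex.cosh (μ * t)‖ * (Real.exp (-Real.sqrt x * Real.cosh t) * x ^ (w.re - 1)) := by
      intro x hx
      rw [norm_mul, norm_mul, Complex.norm_cpow_eq_rpow_re_of_pos hx, Complex.norm_exp]
      rw [← Complex.ofReal_neg, ← Complex.ofReal_mul, Complex.ofReal_re]
      simp
      ring
    rw [setIntegral_congr_fun measurableSet_Ioi e, integral_const_mul, norm_mul,
      Complex.norm_cpow_eq_rpow_re_of_pos (Real.cosh_pos t)]
    have e2 : ∫ x in Ioi (0 : ℝ), (Real.exp (-Real.sqrt x * Real.cosh t) * x ^ (w.re - 1)) =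
        2 * Real.Gamma (2 * w.re) * Real.cosh t ^ (-(2 * w.re)) := by
      apply Complex.ofReal_injective
      rw [← integral_complex_ofReal]
      rw [Complex.ofReal_mul, Complex.ofReal_mul, ← Complex.Gamma_ofReal,
        Complex.ofReal_cpow (Real.cosh_pos t).le]
      push_cast at hr ⊢
      rw [← hr]
      refine setIntegral_congr_fun measurableSet_Ioi fun x hx => ?_
      have hx' : (0:ℝ) ≤ x := le_of_lt hx
      rw [Complex.ofReal_cpow hx']
      push_cast
      rfl
    rw [e2]
    simp
    ring

lemma besselK_mul_cpow_eq_integral (μ w : ℂ) (x : ℝ) :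
    besselK μ (Real.sqrt x) * (x : ℂ) ^ (w - 1) = ∫ t in Ioi (0 : ℝ),
      Complex.exp (-(Real.sqrt x : ℂ) * Real.cosh t) * Complex.cosh (μ * t) *
        (x : ℂ) ^ (w - 1) := by
  rw [besselK, integral_mul_const]

lemma integrableOn_besselK_mul_cpow {w μ : ℂ} (h : |μ.re| < 2 * w.re) :
    IntegrableOn (fun x : ℝ => besselK μ (Real.sqrt x) * (x : ℂ) ^ (w - 1)) (Ioi 0) := by
  simp_rw [besselK_mul_cpow_eq_integral]
  exact (integrable_besselK_kernel h).integral_prod_left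

lemma integral_besselK_mul_cpow {w μ : ℂ} (h : |μ.re| < 2 * w.re) :
    ∫ x in Ioi (0 : ℝ), besselK μ (Real.sqrt x) * (x : ℂ) ^ (w - 1) =
      4 ^ w / 2 * Complex.Gamma (w + μ / 2) * Complex.Gamma (w - μ / 2) := by
  have hw : 0 < w.re := by linarith [abs_nonneg μ.re]
  obtain ⟨h1, h2⟩ := abs_lt.1 h
  simp_rw [besselK_mul_cpow_eq_integral]
  rw [integral_integral_swap (integrable_besselK_kernel h)]
  have e (t : ℝ) : ∫ x in Ioi (0 : ℝ), Complex.exp (-(Real.sqrt x : ℂ) * Real.cosh t) *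
      Complex.cosh (μ * t) * (x : ℂ) ^ (w - 1) =
      2 * Complex.Gamma (2 * w) * ((Real.cosh t : ℂ) ^ (-(2 * w)) * Complex.cosh (μ * t)) := by
    rw [← mul_assoc, ← integral_exp_neg_sqrt_mul_cpow hw (Real.cosh_pos t), ← integral_mul_const]
    congr 1 with x
    ring
  simp_rw [e]
  rw [integral_const_mul, integral_cosh_cpow_mul_cosh h, mul_assoc (4 ^ w / 2),
    Complex.Gamma_mul_Gamma_eq_betaIntegral (by simp; linarith) (by simp; linarith),
    show w + μ / 2 + (w - μ / 2) = 2 * w by ring]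
  ring

lemma norm_Gamma_half_add_mul_I (τ : ℝ) :
    ‖Complex.Gamma (1 / 2 + τ * Complex.I)‖ ^ 2 = Real.pi / Real.cosh (Real.pi * τ) := by
  have h := Complex.Gamma_mul_Gamma_one_sub (1 / 2 + τ * Complex.I)
  have e : (1 : ℂ) - (1 / 2 + τ * Complex.I) = (starRingEnd ℂ) (1 / 2 + τ * Complex.I) := by
    simp [Complex.ext_iff]; norm_num
  have e2 : Complex.sin (Real.pi * (1 / 2 + τ * Complex.I)) = Complex.cosh (Real.pi * τ) := by
    rw [show (Real.pi : ℂ) * (1 / 2 + τ * Complex.I) =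
      (Real.pi * τ) * Complex.I + Real.pi / 2 by ring, Complex.sin_add_pi_div_two, Complex.cos_mul_I]
  rw [e, Complex.Gamma_conj, Complex.mul_conj, Complex.normSq_eq_norm_sq, e2] at h
  exact_mod_cast h

lemma Gamma_le_norm_Gamma_mul {a : ℝ} (ha : 1 / 2 < a) (τ : ℝ) :
    Real.Gamma a ≤ ‖Complex.Gamma (a + τ * Complex.I)‖ * Real.sqrt (Real.cosh (Real.pi * τ)) := by
  set u : ℂ := 1 / 2 + τ * Complex.I with hu
  have hu_re : u.re = 1 / 2 := by simp [hu]
  set v : ℂ := ((a - 1 / 2 : ℝ) : ℂ) with hv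
  have hv_re : v.re = a - 1 / 2 := by simp [hv]
  have hc := Real.cosh_pos (Real.pi * τ)
  have hvpos : 0 < Real.Gamma (a - 1 / 2) := Real.Gamma_pos_of_pos (by linarith)
  have hapos : 0 < Real.Gamma a := Real.Gamma_pos_of_pos (by linarith)
  have h1 := Complex.Gamma_mul_Gamma_eq_betaIntegral (s := u) (t := v)
    (by rw [hu_re]; norm_num) (by rw [hv_re]; linarith)
  have h2 := Complex.Gamma_mul_Gamma_eq_betaIntegral (s := ((1 / 2 : ℝ) : ℂ)) (t := v)
    (by rw [Complex.ofReal_re]; norm_num) (by rw [hv_re]; linarith)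
  have huv : u + v = a + τ * Complex.I := by rw [hu, hv]; push_cast; ring
  have huv2 : ((1 / 2 : ℝ) : ℂ) + v = (a : ℂ) := by rw [hv]; push_cast; ring
  have hbeta : ‖Complex.betaIntegral u v‖ ≤ ‖Complex.betaIntegral ((1 / 2 : ℝ) : ℂ) v‖ := by
    rw [betaIntegral_eq_integral_Ioi, betaIntegral_eq_integral_Ioi]
    refine (norm_integral_le_integral_norm _).trans (le_of_eq ?_)
    have e : ∀ θ ∈ Ioi (0 : ℝ), ‖Complex.exp (-(θ * u)) *
        ((1 - Real.exp (-θ) : ℝ) : ℂ) ^ (v - 1)‖ =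
        Real.exp (-(θ * (1 / 2))) * (1 - Real.exp (-θ)) ^ (a - 1 / 2 - 1) := by
      intro θ hθ
      rw [norm_beta_integrand _ _ hθ, hu_re, hv_re]
    have e' : ∀ θ ∈ Ioi (0 : ℝ), Complex.exp (-(θ * ((1 / 2 : ℝ) : ℂ))) *
        ((1 - Real.exp (-θ) : ℝ) : ℂ) ^ (v - 1) =
        ((Real.exp (-(θ * (1 / 2))) * (1 - Real.exp (-θ)) ^ (a - 1 / 2 - 1) : ℝ) : ℂ) := by
      intro θ hθ
      rw [Complex.ofReal_mul, Complex.ofReal_cpow (one_sub_exp_neg_pos hθ).le, hv]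
      push_cast
      rfl
    rw [setIntegral_congr_fun measurableSet_Ioi e, setIntegral_congr_fun measurableSet_Ioi e',
      integral_complex_ofReal, Complex.norm_real, Real.norm_of_nonneg]
    exact setIntegral_nonneg measurableSet_Ioi fun θ hθ => by
      have := one_sub_exp_neg_pos hθ
      positivity
  rw [huv] at h1
  rw [huv2, hv, Complex.Gamma_ofReal, Complex.Gamma_ofReal, Complex.Gamma_ofReal,
    Real.Gamma_one_half_eq, ← hv] at h2
  have n1 := congrArg norm h1
  have n2 := congrArg norm h2
  rw [hv, Complex.Gamma_ofReal, ← hv, norm_mul, norm_mul, Complex.norm_real,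
    Real.norm_of_nonneg hvpos.le] at n1
  rw [norm_mul, norm_mul, Complex.norm_real, Complex.norm_real, Complex.norm_real,
    Real.norm_of_nonneg hvpos.le, Real.norm_of_nonneg hapos.le,
    Real.norm_of_nonneg (Real.sqrt_nonneg _)] at n2
  have hG : ‖Complex.Gamma u‖ = Real.sqrt Real.pi / Real.sqrt (Real.cosh (Real.pi * τ)) := by
    rw [← Real.sqrt_div Real.pi_pos.le, ← norm_Gamma_half_add_mul_I, Real.sqrt_sq (norm_nonneg _)]
  rw [hG] at n1
  have hsp : 0 < Real.sqrt Real.pi := Real.sqrt_pos.2 Real.pi_pos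
  have hsc : 0 < Real.sqrt (Real.cosh (Real.pi * τ)) := Real.sqrt_pos.2 hc
  set X := ‖Complex.Gamma (a + τ * Complex.I)‖
  set b := ‖Complex.betaIntegral u v‖
  set b0 := ‖Complex.betaIntegral ((1 / 2 : ℝ) : ℂ) v‖
  have hb0 : 0 < b0 := by
    by_contra hcon
    have : b0 = 0 := le_antisymm (not_lt.1 hcon) (norm_nonneg _)
    rw [this, mul_zero] at n2
    exact absurd n2 (by positivity)
  rw [div_mul_eq_mul_div, div_eq_iff hsc.ne', n2] at n1
  have hX : 0 ≤ X := norm_nonneg _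
  refine le_of_mul_le_mul_right ?_ hb0
  rw [n1]
  calc X * b * Real.sqrt (Real.cosh (Real.pi * τ))
      ≤ X * b0 * Real.sqrt (Real.cosh (Real.pi * τ)) := by gcongr
    _ = _ := by ring

/-- The Macdonald function of real order, as a real number. -/
noncomputable def besselKReal (α x : ℝ) : ℝ :=
  ∫ t in Ioi (0 : ℝ), Real.exp (-x * Real.cosh t) * Real.cosh (α * t)

lemma besselK_ofReal (α x : ℝ) : besselK α x = besselKReal α x := by
  rw [besselK, besselKReal, ← integral_complex_ofReal]
  push_cast
  rfl

lemma besselKReal_nonneg (α x : ℝ) : 0 ≤ besselKReal α x :=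
  integral_nonneg fun t => by positivity [Real.cosh_pos (α * t)]

lemma integrableOn_besselKReal_kernel (α : ℝ) {x : ℝ} (hx : 0 < x) :
    IntegrableOn (fun t : ℝ => Real.exp (-x * Real.cosh t) * Real.cosh (α * t)) (Ioi 0) := by
  obtain ⟨n, hn⟩ := exists_nat_ge (|α| + 1)
  have hdom : IntegrableOn (fun t : ℝ => (n.factorial * (2 / x) ^ n) * Real.exp (-1 * t)) (Ioi 0) :=
    (integrableOn_exp_mul_Ioi (by norm_num) 0).const_mul _
  refine Integrable.mono' hdom (by fun_prop) ?_
  filter_upwards [ae_restrict_mem measurableSet_Ioi] with t ht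
  have ht' : (0 : ℝ) < t := ht
  have hc : Real.exp t / 2 ≤ Real.cosh t := by
    rw [Real.cosh_eq]; linarith [Real.exp_pos (-t)]
  have h1 : (x * (Real.exp t / 2)) ^ n / n.factorial ≤ Real.exp (x * Real.cosh t) :=
    (Real.pow_div_factorial_le_exp _ (by positivity) n).trans
      (Real.exp_le_exp.2 (by gcongr))
  have h2 : Real.cosh (α * t) ≤ Real.exp (|α| * t) := by
    rw [← Real.cosh_abs, abs_mul, abs_of_pos ht', Real.cosh_eq]
    have : Real.exp (-(|α| * t)) ≤ Real.exp (|α| * t) := Real.exp_le_exp.2 (by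
      have : 0 ≤ |α| * t := by positivity
      linarith)
    linarith
  have h3 : Real.exp (|α| * t) ≤ Real.exp t ^ n * Real.exp (-1 * t) := by
    rw [← Real.exp_nat_mul, ← Real.exp_add]
    apply Real.exp_le_exp.2
    nlinarith
  have hcp := Real.cosh_pos (α * t)
  rw [Real.norm_of_nonneg (by positivity), neg_mul, Real.exp_neg]
  calc (Real.exp (x * Real.cosh t))⁻¹ * Real.cosh (α * t)
      ≤ ((x * (Real.exp t / 2)) ^ n / n.factorial)⁻¹ * (Real.exp t ^ n * Real.exp (-1 * t)) := by
        have := h2.trans h3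
        gcongr
    _ = _ := by
        have := (Real.exp_pos t).ne'
        field_simp
        rw [← mul_pow]
        congr 1
        field_simp

lemma norm_cosh_le (z : ℂ) : ‖Complex.cosh z‖ ≤ Real.cosh z.re := by
  rw [Complex.cosh, Real.cosh_eq, norm_div]
  have := norm_add_le (Complex.exp z) (Complex.exp (-z))
  rw [Complex.norm_exp, Complex.norm_exp, Complex.neg_re] at this
  simpa using div_le_div_of_nonneg_right this zero_le_two

lemma norm_besselK_le (α τ : ℝ) {x : ℝ} (hx : 0 < x) :
    ‖besselK (α + τ * Complex.I) x‖ ≤ besselKReal α x := by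
  refine (norm_integral_le_integral_norm _).trans ?_
  refine integral_mono_of_nonneg (ae_of_all _ fun t => norm_nonneg _)
    (integrableOn_besselKReal_kernel α hx) (ae_of_all _ fun t => ?_)
  simp only [norm_mul]
  have := norm_cosh_le ((α + τ * Complex.I) * t)
  gcongr
  · rw [Complex.norm_exp, ← Complex.ofReal_neg, ← Complex.ofReal_mul, Complex.ofReal_re]
  · simpa using this

/-- The terms of the series for `K_{α+iτ}(√x) I_{α-iτ}(√x) x^(s-1)`. -/
noncomputable def besselTerm (α : ℝ) (s : ℂ) (τ : ℝ) (k : ℕ) (x : ℝ) : ℂ :=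
  besselK (α + τ * Complex.I) (Real.sqrt x) *
    (((Real.sqrt x : ℂ) / 2) ^ (α - τ * Complex.I + 2 * (k : ℂ)) /
      ((Nat.factorial k : ℂ) * Complex.Gamma (α - τ * Complex.I + (k : ℂ) + 1))) *
    (x : ℂ) ^ (s - 1)

lemma sqrt_div_two_cpow {x : ℝ} (hx : 0 < x) (z : ℂ) :
    ((Real.sqrt x : ℂ) / 2) ^ z = (2 : ℂ) ^ (-z) * (x : ℂ) ^ (z / 2) := by
  have hx0 : (x : ℂ) ≠ 0 := by exact_mod_cast hx.ne'
  have h2 : Real.sqrt x / 2 = 2⁻¹ * Real.sqrt x := by ring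
  rw [show ((Real.sqrt x : ℂ) / 2) = (((2 : ℝ)⁻¹ : ℝ) : ℂ) * (Real.sqrt x : ℂ) by push_cast; ring,
    Complex.mul_cpow_ofReal_nonneg (by norm_num) (Real.sqrt_nonneg _)]
  congr 1
  · rw [Complex.ofReal_inv, Complex.inv_cpow, Complex.cpow_neg]
    · simp
    · rw [Complex.arg_ofReal_of_nonneg (by norm_num)]; exact Real.pi_pos.ne
  · rw [Complex.cpow_def_of_ne_zero (by exact_mod_cast (Real.sqrt_pos.2 hx).ne'),
      Complex.cpow_def_of_ne_zero hx0, ← Complex.ofReal_log hx.le,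
      ← Complex.ofReal_log (Real.sqrt_nonneg _), Real.log_sqrt hx.le]
    congr 1
    push_cast
    ring

lemma besselTerm_eq (α : ℝ) (s : ℂ) (τ : ℝ) (k : ℕ) {x : ℝ} (hx : 0 < x) :
    besselTerm α s τ k x = (2 : ℂ) ^ (-(α - τ * Complex.I + 2 * (k : ℂ))) /
      ((Nat.factorial k : ℂ) * Complex.Gamma (α - τ * Complex.I + (k : ℂ) + 1)) *
      (besselK (α + τ * Complex.I) (Real.sqrt x) *
        (x : ℂ) ^ ((s + (α - τ * Complex.I) / 2 + k) - 1)) := by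
  have hx0 : (x : ℂ) ≠ 0 := by exact_mod_cast hx.ne'
  rw [besselTerm, sqrt_div_two_cpow hx, show (s + (α - τ * Complex.I) / 2 + k) - 1 =
    (α - τ * Complex.I + 2 * (k : ℂ)) / 2 + (s - 1) by ring, Complex.cpow_add _ _ hx0]
  ring

lemma besselTerm_cond {α : ℝ} {s : ℂ} (h0 : 0 < s.re) (hα : -α < s.re) (τ : ℝ) (k : ℕ) :
    |((α : ℂ) + τ * Complex.I).re| < 2 * (s + (α - τ * Complex.I) / 2 + k).re := by
  have : (0 : ℝ) ≤ k := Nat.cast_nonneg k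
  have e : (s + (α - τ * Complex.I) / 2 + k).re = s.re + α / 2 + k := by
    rw [show (s + (α - τ * Complex.I) / 2 + k) =
      s + ((α / 2 : ℝ) : ℂ) + (k : ℝ) + ((-τ / 2 : ℝ) : ℂ) * Complex.I by push_cast; ring]
    simp
  rw [e]
  simp only [Complex.add_re, Complex.ofReal_re, Complex.mul_re, Complex.I_re, Complex.ofReal_im,
    Complex.I_im, mul_zero, mul_one, sub_self, add_zero]
  rw [abs_lt]
  constructor <;> linarith

lemma integrableOn_besselTerm {α : ℝ} {s : ℂ} (h0 : 0 < s.re) (hα : -α < s.re) (τ : ℝ) (k : ℕ) :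
    IntegrableOn (besselTerm α s τ k) (Ioi 0) :=
  IntegrableOn.congr_fun ((integrableOn_besselK_mul_cpow (besselTerm_cond h0 hα τ k)).const_mul _)
    (fun _ hx => (besselTerm_eq α s τ k hx).symm) measurableSet_Ioi

lemma integral_besselTerm {α : ℝ} {s : ℂ} (h0 : 0 < s.re) (hα : -α < s.re) (τ : ℝ) (k : ℕ) :
    ∫ x in Ioi (0 : ℝ), besselTerm α s τ k x = 4 ^ s / 2 *
      (Complex.Gamma (s + α + k) * Complex.Gamma (s - τ * Complex.I + k) /
        ((Nat.factorial k : ℂ) * Complex.Gamma (α - τ * Complex.I + 1 + k))) := by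
  rw [setIntegral_congr_fun measurableSet_Ioi (fun x hx => besselTerm_eq α s τ k hx),
    integral_const_mul, integral_besselK_mul_cpow (besselTerm_cond h0 hα τ k)]
  have e4 : (4 : ℂ) ^ (s + (α - τ * Complex.I) / 2 + k) =
      4 ^ s * 2 ^ (α - τ * Complex.I + 2 * (k : ℂ)) := by
    have : (4 : ℂ) = ((2 : ℝ) : ℂ) * ((2 : ℝ) : ℂ) := by norm_num
    rw [this, Complex.mul_cpow_ofReal_nonneg zero_le_two zero_le_two,
      Complex.mul_cpow_ofReal_nonneg zero_le_two zero_le_two, Complex.ofReal_ofNat,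
      ← Complex.cpow_add _ _ two_ne_zero, ← Complex.cpow_add _ _ two_ne_zero,
      ← Complex.cpow_add _ _ two_ne_zero]
    congr 1
    ring
  rw [e4, Complex.cpow_neg,
    show s + (α - τ * Complex.I) / 2 + k + (α + τ * Complex.I) / 2 = s + α + k by ring,
    show s + (α - τ * Complex.I) / 2 + k - (α + τ * Complex.I) / 2 = s - τ * Complex.I + k by ring,
    show (α - τ * Complex.I + (k : ℂ) + 1) = α - τ * Complex.I + 1 + k by ring]
  have h2 : (2 : ℂ) ^ (α - τ * Complex.I + 2 * (k : ℂ)) ≠ 0 := by simp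
  generalize (2 : ℂ) ^ (α - τ * Complex.I + 2 * (k : ℂ)) = P at *
  rw [div_mul_eq_mul_div, mul_comm (P⁻¹), mul_div_assoc']
  congr 1
  field_simp

lemma hasSum_integral_besselTerm {α : ℝ} {s : ℂ} (h0 : 0 < s.re) (hα : -α < s.re)
    (h1 : s.re < 1 / 2) (τ : ℝ) :
    HasSum (fun k => ∫ x in Ioi (0 : ℝ), besselTerm α s τ k x)
      (4 ^ s / 2 * (Complex.Gamma (s + α) / Complex.Gamma (1 + α - s) *
        ∫ θ in Ioi (0 : ℝ), Complex.exp (-(θ * (s - τ * Complex.I))) *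
          ((1 - Real.exp (-θ) : ℝ) : ℂ) ^ (-2 * s))) := by
  have key := hasSum_Gamma_quotient (a := s + α) (b := s - τ * Complex.I)
    (c := α - τ * Complex.I + 1) (by simp; linarith) (by simpa using h0)
    (by simp; linarith) (by simp; linarith)
  rw [show (α - τ * Complex.I + 1) - (s - τ * Complex.I) = 1 + α - s by ring,
    show (α - τ * Complex.I + 1) - (s + α) - (s - τ * Complex.I) - 1 = -2 * s by ring] at key
  refine (key.mul_left (4 ^ s / 2)).congr_fun fun k => ?_
  exact integral_besselTerm h0 hα τ k

/-- Majorant of `besselTerm`. -/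
noncomputable def besselTermReal (α ν : ℝ) (k : ℕ) (x : ℝ) : ℝ :=
  besselKReal α (Real.sqrt x) * ((Real.sqrt x / 2) ^ (α + 2 * (k : ℝ)) /
    ((Nat.factorial k : ℝ) * Real.Gamma (α + k + 1))) * x ^ (ν - 1)

lemma besselTerm_ofReal (α ν : ℝ) (k : ℕ) {x : ℝ} (hx : 0 < x) :
    besselTerm α ν 0 k x = besselTermReal α ν k x := by
  have hs : 0 ≤ Real.sqrt x / 2 := by positivity
  rw [besselTermReal, besselTerm]
  push_cast [Complex.ofReal_cpow hs, Complex.ofReal_cpow hx.le, ← Complex.Gamma_ofReal,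
    ← besselK_ofReal]
  simp

lemma besselTermReal_nonneg {α : ℝ} (hα : -1 < α) (ν : ℝ) (k : ℕ) {x : ℝ} (hx : 0 < x) :
    0 ≤ besselTermReal α ν k x := by
  have h : 0 < Real.Gamma (α + k + 1) := Real.Gamma_pos_of_pos (by
    have : (0 : ℝ) ≤ k := Nat.cast_nonneg k
    linarith)
  have := besselKReal_nonneg α (Real.sqrt x)
  rw [besselTermReal]
  positivity

lemma norm_besselTerm_le {α : ℝ} (hα : -1 / 2 < α) (s : ℂ) (τ : ℝ) (k : ℕ) {x : ℝ} (hx : 0 < x) :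
    ‖besselTerm α s τ k x‖ ≤
      besselTermReal α s.re k x * Real.sqrt (Real.cosh (Real.pi * τ)) := by
  have hk : (0 : ℝ) ≤ k := Nat.cast_nonneg k
  have hsq : 0 < Real.sqrt x := Real.sqrt_pos.2 hx
  have hG : 0 < Real.Gamma (α + k + 1) := Real.Gamma_pos_of_pos (by linarith)
  have hle := Gamma_le_norm_Gamma_mul (a := α + k + 1) (by linarith) (-τ)
  rw [mul_neg, Real.cosh_neg] at hle
  have e : ((α + k + 1 : ℝ) : ℂ) + ((-τ : ℝ) : ℂ) * Complex.I =
    α - τ * Complex.I + (k : ℂ) + 1 := by push_cast; ring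
  rw [e] at hle
  have hc : 0 < Real.sqrt (Real.cosh (Real.pi * τ)) := Real.sqrt_pos.2 (Real.cosh_pos _)
  have hN : 0 < ‖Complex.Gamma (α - τ * Complex.I + (k : ℂ) + 1)‖ := by
    by_contra hcon
    rw [le_antisymm (not_lt.1 hcon) (norm_nonneg _), zero_mul] at hle
    linarith
  have hK := norm_besselK_le α τ hsq
  have hK0 := besselKReal_nonneg α (Real.sqrt x)
  have n1 : ‖((Real.sqrt x : ℂ) / 2) ^ (α - τ * Complex.I + 2 * (k : ℂ))‖ =
      (Real.sqrt x / 2) ^ (α + 2 * (k : ℝ)) := by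
    rw [show (Real.sqrt x : ℂ) / 2 = ((Real.sqrt x / 2 : ℝ) : ℂ) by push_cast; rfl,
      Complex.norm_cpow_eq_rpow_re_of_pos (by positivity)]
    simp
  have n2 : ‖(x : ℂ) ^ (s - 1)‖ = x ^ (s.re - 1) := by
    rw [Complex.norm_cpow_eq_rpow_re_of_pos hx]; simp
  rw [besselTerm, besselTermReal, norm_mul, norm_mul, norm_div, norm_mul, n1, n2,
    Complex.norm_natCast]
  have hfac : (0 : ℝ) < Nat.factorial k := by positivity
  have hp : 0 < (Real.sqrt x / 2) ^ (α + 2 * (k : ℝ)) := by positivity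
  have hinv : 1 / ‖Complex.Gamma (α - τ * Complex.I + (k : ℂ) + 1)‖ ≤
      Real.sqrt (Real.cosh (Real.pi * τ)) / Real.Gamma (α + k + 1) := by
    rw [div_le_div_iff₀ hN hG]; linarith
  calc _ = ‖besselK (α + τ * Complex.I) (Real.sqrt x)‖ *
        ((Real.sqrt x / 2) ^ (α + 2 * (k : ℝ)) / (Nat.factorial k : ℝ)) *
        (1 / ‖Complex.Gamma (α - τ * Complex.I + (k : ℂ) + 1)‖) * x ^ (s.re - 1) := by
        field_simp
    _ ≤ besselKReal α (Real.sqrt x) *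
        ((Real.sqrt x / 2) ^ (α + 2 * (k : ℝ)) / (Nat.factorial k : ℝ)) *
        (Real.sqrt (Real.cosh (Real.pi * τ)) / Real.Gamma (α + k + 1)) * x ^ (s.re - 1) := by
        gcongr
    _ = _ := by field_simp

lemma integrableOn_besselTermReal {α ν : ℝ} (h0 : 0 < ν) (hα : -α < ν) (k : ℕ) :
    IntegrableOn (besselTermReal α ν k) (Ioi 0) := by
  have h := (integrableOn_besselTerm (s := ν) h0 hα 0 k).re
  refine h.congr ?_
  filter_upwards [ae_restrict_mem measurableSet_Ioi] with x hx
  rw [besselTerm_ofReal α ν k hx]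
  simp

lemma summable_integral_besselTermReal {α ν : ℝ} (h0 : 0 < ν) (hα : -α < ν)
    (h1 : ν < 1 / 2) :
    Summable fun k => ∫ x in Ioi (0 : ℝ), besselTermReal α ν k x := by
  have h := Complex.hasSum_re (hasSum_integral_besselTerm (s := ν) h0 hα h1 0)
  refine h.summable.congr fun k => ?_
  rw [setIntegral_congr_fun measurableSet_Ioi fun x hx => besselTerm_ofReal α ν k hx,
    integral_complex_ofReal, Complex.ofReal_re]

lemma integrable_tsum_of_summable_integral_norm {X : Type*} [MeasurableSpace X] {μ : Measure X}
    {F : ℕ → X → ℂ} (hF : ∀ k, Integrable (F k) μ) (hs : Summable fun k => ∫ x, ‖F k x‖ ∂μ) :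
    Integrable (fun x => ∑' k, F k x) μ := by
  have hL : Summable fun k => ‖(hF k).toL1 (F k)‖ :=
    hs.congr fun k => (by simp [Integrable.norm_toL1_eq_lintegral_norm, integral_norm_eq_lintegral_enorm (hF k).1])
  have h1 := Lp.coeFn_tsum (tsum_enorm_ne_top_iff_summable_norm.2 hL)
  have h2 : ∀ᵐ x ∂μ, ∀ k, (hF k).toL1 (F k) x = F k x :=
    ae_all_iff.2 fun k => Integrable.coeFn_toL1 (hF k)
  refine (L1.integrable_coeFn (∑' k, (hF k).toL1 (F k))).congr ?_
  filter_upwards [h1, h2] with x hx1 hx2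
  rw [hx1]
  exact tsum_congr hx2

lemma measurable_besselK (α : ℝ) :
    Measurable fun p : ℝ × ℝ => besselK (α + p.2 * Complex.I) (Real.sqrt p.1) := by
  have h : StronglyMeasurable fun q : (ℝ × ℝ) × ℝ =>
      Complex.exp (-(Real.sqrt q.1.1 : ℂ) * Real.cosh q.2) *
        Complex.cosh ((α + q.1.2 * Complex.I) * q.2) := by
    apply Continuous.stronglyMeasurable
    fun_prop
  exact (StronglyMeasurable.integral_prod_right' (ν := volume.restrict (Ioi (0 : ℝ))) h).measurable

lemma measurable_besselTerm (α : ℝ) (s : ℂ) (k : ℕ) :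
    Measurable fun p : ℝ × ℝ => besselTerm α s p.2 k p.1 := by
  have hG : Measurable fun p : ℝ × ℝ =>
      (Complex.Gamma (α - p.2 * Complex.I + (k : ℂ) + 1))⁻¹ := by
    apply Continuous.measurable
    exact Complex.differentiable_one_div_Gamma.continuous.comp (by fun_prop)
  have h1 : Measurable fun p : ℝ × ℝ =>
      ((Real.sqrt p.1 : ℂ) / 2) ^ (α - p.2 * Complex.I + 2 * (k : ℂ)) := by fun_prop
  have h2 : Measurable fun p : ℝ × ℝ => (p.1 : ℂ) ^ (s - 1) := by fun_prop
  simp only [besselTerm, div_eq_mul_inv, mul_inv] at hG h1 h2 ⊢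
  exact ((measurable_besselK α).mul (h1.mul (measurable_const.mul hG))).mul h2

/-- The Mellin kernel `K_{α+iτ}(√x) I_{α-iτ}(√x) x^(s-1)`. -/
noncomputable def besselKI (α : ℝ) (s : ℂ) (τ x : ℝ) : ℂ :=
  besselK (α + τ * Complex.I) (Real.sqrt x) * besselI (α - τ * Complex.I) (Real.sqrt x) *
    (x : ℂ) ^ (s - 1)

lemma tsum_besselTerm (α : ℝ) (s : ℂ) (τ x : ℝ) :
    ∑' k, besselTerm α s τ k x = besselKI α s τ x := by
  simp only [besselTerm, besselKI, besselI]
  rw [tsum_mul_right, tsum_mul_left]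

/-- The weight `g τ / cosh (π τ)`. -/
noncomputable def coshWeight (g : ℝ → ℝ) (τ : ℝ) : ℝ := g τ / Real.cosh (Real.pi * τ)

lemma integrable_coshWeight {g : ℝ → ℝ} (hg : Integrable g) : Integrable (coshWeight g) := by
  refine Integrable.mono hg ?_ (ae_of_all _ fun τ => ?_)
  · have : Continuous fun τ : ℝ => (Real.cosh (Real.pi * τ))⁻¹ :=
      Continuous.inv₀ (by fun_prop) fun τ => (Real.cosh_pos _).ne'
    exact hg.1.mul this.aestronglyMeasurable
  · rw [coshWeight, norm_div, Real.norm_of_nonneg (Real.cosh_pos (Real.pi * τ)).le]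
    exact div_le_self (norm_nonneg _) (Real.one_le_cosh _)

lemma norm_coshWeight_mul_le (g : ℝ → ℝ) (τ : ℝ) :
    Real.sqrt (Real.cosh (Real.pi * τ)) * ‖(coshWeight g τ : ℂ)‖ ≤ |g τ| := by
  have h1 := Real.one_le_cosh (Real.pi * τ)
  have hc := Real.cosh_pos (Real.pi * τ)
  rw [coshWeight, Complex.norm_real, Real.norm_eq_abs, abs_div, abs_of_pos hc,
    mul_div_assoc', div_le_iff₀ hc, mul_comm]
  gcongr
  rw [Real.sqrt_le_left hc.le]
  nlinarith

lemma integrable_besselTerm_mul {α : ℝ} {s : ℂ} (h0 : 0 < s.re) (hα : -α < s.re)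
    (h1 : s.re < 1 / 2) {g : ℝ → ℝ} (hg : Integrable g) (k : ℕ) :
    Integrable (fun p : ℝ × ℝ => besselTerm α s p.2 k p.1 * coshWeight g p.2)
      ((volume.restrict (Ioi 0)).prod volume) ∧
    ∫ p, ‖besselTerm α s p.2 k p.1 * coshWeight g p.2‖ ∂((volume.restrict (Ioi 0)).prod volume) ≤
      (∫ x in Ioi (0 : ℝ), besselTermReal α s.re k x) * ∫ τ, |g τ| := by
  have hdom := (integrableOn_besselTermReal h0 hα k).mul_prod hg.abs
  have hle : ∀ᵐ p : ℝ × ℝ ∂((volume.restrict (Ioi 0)).prod volume),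
      ‖besselTerm α s p.2 k p.1 * coshWeight g p.2‖ ≤ besselTermReal α s.re k p.1 * |g p.2| := by
    have : ∀ᵐ p : ℝ × ℝ ∂((volume.restrict (Ioi 0)).prod volume), p.1 ∈ Ioi (0 : ℝ) :=
      Measure.quasiMeasurePreserving_fst.ae (ae_restrict_mem measurableSet_Ioi)
    filter_upwards [this] with p hp
    rw [norm_mul]
    have h2 := norm_besselTerm_le (α := α) (by linarith) s p.2 k hp
    have h3 := norm_coshWeight_mul_le g p.2
    have h4 := besselTermReal_nonneg (α := α) (by linarith) s.re k hp
    calc _ ≤ besselTermReal α s.re k p.1 * Real.sqrt (Real.cosh (Real.pi * p.2)) *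
          ‖(coshWeight g p.2 : ℂ)‖ := by gcongr
      _ = besselTermReal α s.re k p.1 * (Real.sqrt (Real.cosh (Real.pi * p.2)) *
          ‖(coshWeight g p.2 : ℂ)‖) := by ring
      _ ≤ _ := by gcongr
  have hm : AEStronglyMeasurable (fun p : ℝ × ℝ => besselTerm α s p.2 k p.1 * coshWeight g p.2)
      ((volume.restrict (Ioi 0)).prod volume) :=
    (measurable_besselTerm α s k).aestronglyMeasurable.mul
      ((integrable_coshWeight hg).ofReal (𝕜 := ℂ)).1.comp_snd
  have hFint : Integrable (fun p : ℝ × ℝ => besselTerm α s p.2 k p.1 * coshWeight g p.2)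
      ((volume.restrict (Ioi 0)).prod volume) := Integrable.mono' hdom hm hle
  refine ⟨hFint, ?_⟩
  rw [← integral_prod_mul]
  exact integral_mono_ae hFint.norm hdom hle

lemma integrable_besselKI_mul {α : ℝ} {s : ℂ} (h0 : 0 < s.re) (hα : -α < s.re)
    (h1 : s.re < 1 / 2) {g : ℝ → ℝ} (hg : Integrable g) :
    Integrable (fun p : ℝ × ℝ => besselKI α s p.2 p.1 * coshWeight g p.2)
      ((volume.restrict (Ioi 0)).prod volume) := by
  have h := fun k => integrable_besselTerm_mul (α := α) h0 hα h1 hg k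
  have hs : Summable fun k => ∫ p, ‖besselTerm α s p.2 k p.1 * coshWeight g p.2‖
      ∂((volume.restrict (Ioi 0)).prod volume) :=
    Summable.of_nonneg_of_le (fun k => integral_nonneg fun p => norm_nonneg _) (fun k => (h k).2)
      ((summable_integral_besselTermReal h0 hα h1).mul_right _)
  refine (integrable_tsum_of_summable_integral_norm (fun k => (h k).1) hs).congr
    (ae_of_all _ fun p => ?_)
  simp only [tsum_mul_right, tsum_besselTerm]

lemma summable_integral_norm_besselTerm {α : ℝ} {s : ℂ} (h0 : 0 < s.re) (hα : -α < s.re)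
    (h1 : s.re < 1 / 2) (τ : ℝ) :
    Summable fun k => ∫ x in Ioi (0 : ℝ), ‖besselTerm α s τ k x‖ := by
  refine Summable.of_nonneg_of_le (fun k => integral_nonneg fun p => norm_nonneg _) (fun k => ?_)
    ((summable_integral_besselTermReal h0 hα h1).mul_right
      (Real.sqrt (Real.cosh (Real.pi * τ))))
  rw [← integral_mul_const]
  exact setIntegral_mono_on (integrableOn_besselTerm h0 hα τ k).norm
    ((integrableOn_besselTermReal h0 hα k).mul_const _) measurableSet_Ioi
    fun x hx => norm_besselTerm_le (by linarith) s τ k hx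

lemma integral_besselKI {α : ℝ} {s : ℂ} (h0 : 0 < s.re) (hα : -α < s.re)
    (h1 : s.re < 1 / 2) (τ : ℝ) :
    ∫ x in Ioi (0 : ℝ), besselKI α s τ x =
      4 ^ s / 2 * (Complex.Gamma (s + α) / Complex.Gamma (1 + α - s) *
        ∫ θ in Ioi (0 : ℝ), Complex.exp (-(θ * (s - τ * Complex.I))) *
          ((1 - Real.exp (-θ) : ℝ) : ℂ) ^ (-2 * s)) := by
  have hFint := fun k => integrableOn_besselTerm (α := α) h0 hα τ k
  have h := hasSum_integral_of_summable_integral_norm hFint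
    (summable_integral_norm_besselTerm h0 hα h1 τ)
  simp only [tsum_besselTerm] at h
  exact h.unique (hasSum_integral_besselTerm h0 hα h1 τ)

lemma integrableOn_besselKI {α : ℝ} {s : ℂ} (h0 : 0 < s.re) (hα : -α < s.re)
    (h1 : s.re < 1 / 2) (τ : ℝ) : IntegrableOn (besselKI α s τ) (Ioi 0) := by
  have hFint := fun k => integrableOn_besselTerm (α := α) h0 hα τ k
  refine (integrable_tsum_of_summable_integral_norm hFint
    (summable_integral_norm_besselTerm h0 hα h1 τ)).congr (ae_of_all _ fun x => ?_)
  exact tsum_besselTerm α s τ x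

/-- The function `sinh² (θ / 2)`. -/
noncomputable def sinhSq (θ : ℝ) : ℝ := Real.sinh (θ / 2) ^ 2

lemma sinhSq_pos {θ : ℝ} (hθ : 0 < θ) : 0 < sinhSq θ :=
  pow_pos (Real.sinh_pos_iff.2 (half_pos hθ)) 2

lemma sinhSq_eq (θ : ℝ) : sinhSq θ = Real.exp θ * (1 - Real.exp (-θ)) ^ 2 / 4 := by
  have h1 : Real.exp θ = Real.exp (θ / 2) ^ 2 := by
    rw [← Real.exp_nat_mul]; congr 1; push_cast; ring
  rw [sinhSq, Real.sinh_eq, h1, Real.exp_neg, Real.exp_neg, h1]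
  have := (Real.exp_pos (θ / 2)).ne'
  field_simp
  ring

lemma log_sinhSq {θ : ℝ} (hθ : 0 < θ) :
    Real.log (sinhSq θ) = θ + 2 * Real.log (1 - Real.exp (-θ)) - Real.log 4 := by
  have h := one_sub_exp_neg_pos hθ
  rw [sinhSq_eq, Real.log_div (by positivity) (by norm_num),
    Real.log_mul (by positivity) (by positivity), Real.log_exp, Real.log_pow]
  push_cast
  ring

lemma sinhSq_cpow_neg {θ : ℝ} (hθ : 0 < θ) (s : ℂ) :
    (sinhSq θ : ℂ) ^ (-s) =
      4 ^ s * (Complex.exp (-(θ * s)) * ((1 - Real.exp (-θ) : ℝ) : ℂ) ^ (-2 * s)) := by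
  have h := one_sub_exp_neg_pos hθ
  have h4 : (4 : ℂ) = ((4 : ℝ) : ℂ) := by norm_num
  rw [Complex.cpow_def_of_ne_zero (by exact_mod_cast (sinhSq_pos hθ).ne'),
    Complex.cpow_def_of_ne_zero (Complex.ofReal_ne_zero.2 h.ne'), h4,
    Complex.cpow_def_of_ne_zero (by norm_num),
    ← Complex.ofReal_log (sinhSq_pos hθ).le, ← Complex.ofReal_log h.le,
    ← Complex.ofReal_log (by norm_num), log_sinhSq hθ, ← Complex.exp_add, ← Complex.exp_add]
  congr 1
  push_cast
  ring

lemma conj_besselKI_kernel {θ : ℝ} (hθ : 0 < θ) (s : ℂ) (τ : ℝ) :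
    conj (Complex.exp (-(θ * (conj s - τ * Complex.I))) *
      ((1 - Real.exp (-θ) : ℝ) : ℂ) ^ (-2 * conj s)) =
    Complex.exp (-(θ * (s + τ * Complex.I))) * ((1 - Real.exp (-θ) : ℝ) : ℂ) ^ (-2 * s) := by
  have h := one_sub_exp_neg_pos hθ
  have e : -2 * conj s = conj (-2 * s) := by rw [map_mul, map_neg, map_ofNat]
  rw [map_mul, ← Complex.exp_conj, e, Complex.cpow_conj _ _ (by
    rw [Complex.arg_ofReal_of_nonneg h.le]; exact Real.pi_pos.ne), Complex.conj_conj,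
    Complex.conj_ofReal]
  congr 2
  simp

lemma integrableOn_kernel {s : ℂ} (h0 : 0 < s.re) (h1 : s.re < 1 / 2) (τ : ℝ) :
    IntegrableOn (fun θ : ℝ => Complex.exp (-(θ * (s - τ * Complex.I))) *
      ((1 - Real.exp (-θ) : ℝ) : ℂ) ^ (-2 * s)) (Ioi 0) := by
  have h := integrableOn_beta_integrand (u := s - τ * Complex.I) (v := 1 - 2 * s)
    (by simpa using h0) (by simp; linarith)
  rwa [show (1 - 2 * s) - 1 = -2 * s by ring] at h

lemma integral_besselKI_add_conj {α : ℝ} {s : ℂ} (h0 : 0 < s.re) (hα : -α < s.re)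
    (h1 : s.re < 1 / 2) (τ : ℝ) :
    ∫ x in Ioi (0 : ℝ), (besselKI α s τ x + conj (besselKI α (conj s) τ x)) =
      Complex.Gamma (s + α) / Complex.Gamma (1 + α - s) *
        ∫ θ in Ioi (0 : ℝ), (Real.cos (τ * θ) : ℂ) * (sinhSq θ : ℂ) ^ (-s) := by
  have c0 : 0 < (conj s).re := by simpa using h0
  have cα : -α < (conj s).re := by simpa using hα
  have c1 : (conj s).re < 1 / 2 := by simpa using h1
  have hI := integrableOn_besselKI c0 cα c1 τ
  have hI' : IntegrableOn (fun x => conj (besselKI α (conj s) τ x)) (Ioi 0) :=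
    Complex.conjCLE.toContinuousLinearMap.integrable_comp hI
  rw [integral_add (integrableOn_besselKI h0 hα h1 τ) hI', integral_conj,
    integral_besselKI h0 hα h1, integral_besselKI c0 cα c1, map_mul, map_mul, ← integral_conj,
    setIntegral_congr_fun measurableSet_Ioi fun θ hθ => conj_besselKI_kernel hθ s τ]
  have e1 : conj ((4 : ℂ) ^ conj s / 2) = 4 ^ s / 2 := by
    rw [map_div₀, Complex.cpow_conj]
    · rw [Complex.conj_conj, map_ofNat, map_ofNat]
    · rw [show (4 : ℂ) = ((4 : ℝ) : ℂ) by norm_num, Complex.arg_ofReal_of_nonneg (by norm_num)]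
      exact Real.pi_pos.ne
  have e2 : conj (Complex.Gamma (conj s + α) / Complex.Gamma (1 + α - conj s)) =
      Complex.Gamma (s + α) / Complex.Gamma (1 + α - s) := by
    rw [map_div₀, ← Complex.Gamma_conj, ← Complex.Gamma_conj]
    simp
  have hk := integrableOn_kernel h0 h1 τ
  have hk' : IntegrableOn (fun θ : ℝ => Complex.exp (-(θ * (s + τ * Complex.I))) *
      ((1 - Real.exp (-θ) : ℝ) : ℂ) ^ (-2 * s)) (Ioi 0) := by
    have := integrableOn_kernel h0 h1 (-τ)
    push_cast at this ⊢
    simpa only [neg_mul, sub_neg_eq_add] using this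
  rw [e1, e2, ← mul_add, ← mul_add, ← integral_add hk hk', mul_left_comm, ← integral_const_mul]
  congr 1
  refine setIntegral_congr_fun measurableSet_Ioi fun θ hθ => ?_
  have hc : (Real.cos (τ * θ) : ℂ) = (Complex.exp (θ * τ * Complex.I) +
      Complex.exp (-(θ * τ * Complex.I))) / 2 := by
    rw [Complex.ofReal_cos, Complex.cos]
    push_cast
    congr 3 <;> ring_nf
  rw [hc, sinhSq_cpow_neg hθ, show -((θ : ℂ) * (s - τ * Complex.I)) =
    -(θ * s) + θ * τ * Complex.I by ring, show -((θ : ℂ) * (s + τ * Complex.I)) =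
    -(θ * s) + -(θ * τ * Complex.I) by ring, Complex.exp_add, Complex.exp_add]
  ring

lemma Gtrans_mul_cpow (α : ℝ) (g : ℝ → ℝ) (s : ℂ) {x : ℝ} (hx : 0 < x) :
    (Gtrans α g x : ℂ) * (x : ℂ) ^ (s - 1) = Real.sqrt Real.pi *
      ∫ τ : ℝ, (besselKI α s τ x + conj (besselKI α (conj s) τ x)) * coshWeight g τ := by
  have hxc : conj ((x : ℂ) ^ (conj s - 1)) = (x : ℂ) ^ (s - 1) := by
    rw [show conj s - 1 = conj (s - 1) by simp, Complex.cpow_conj _ _ (by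
      rw [Complex.arg_ofReal_of_nonneg hx.le]; exact Real.pi_pos.ne), Complex.conj_conj,
      Complex.conj_ofReal]
  rw [Gtrans, Complex.ofReal_mul, ← integral_complex_ofReal, mul_assoc, ← integral_mul_const,
    Complex.ofReal_mul, mul_assoc, mul_left_comm, ← integral_const_mul]
  congr 2
  ext τ
  simp only [besselKI, map_mul, hxc]
  set z := besselK (α + τ * Complex.I) (Real.sqrt x) * besselI (α - τ * Complex.I) (Real.sqrt x)
    with hz
  have h2 : ((2 : ℝ) : ℂ) * (z.re : ℂ) = z + conj z := by
    rw [Complex.add_conj]; push_cast; rfl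
  rw [← map_mul, ← hz, ← add_mul, ← h2, coshWeight]
  push_cast
  ring

lemma mellinT_Gtrans {α : ℝ} {s : ℂ} (h0 : 0 < s.re) (hα : -α < s.re)
    (h1 : s.re < 1 / 2) {g : ℝ → ℝ} (hg : Integrable g) :
    mellinT (Gtrans α g) s = Real.sqrt Real.pi *
      (Complex.Gamma (s + α) / Complex.Gamma (1 + α - s) *
        ∫ τ : ℝ, (∫ θ in Ioi (0 : ℝ), (Real.cos (τ * θ) : ℂ) * (sinhSq θ : ℂ) ^ (-s)) *
          coshWeight g τ) := by
  have c0 : 0 < (conj s).re := by simpa using h0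
  have cα : -α < (conj s).re := by simpa using hα
  have c1 : (conj s).re < 1 / 2 := by simpa using h1
  have i1 := integrable_besselKI_mul h0 hα h1 hg
  have i2 : Integrable (fun p : ℝ × ℝ => conj (besselKI α (conj s) p.2 p.1 * coshWeight g p.2))
      ((volume.restrict (Ioi 0)).prod volume) :=
    Complex.conjCLE.toContinuousLinearMap.integrable_comp (integrable_besselKI_mul c0 cα c1 hg)
  have i3 : Integrable (Function.uncurry fun x τ : ℝ => (besselKI α s τ x +
      conj (besselKI α (conj s) τ x)) * coshWeight g τ)
      ((volume.restrict (Ioi 0)).prod volume) := by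
    refine (i1.add i2).congr (ae_of_all _ fun p => ?_)
    simp [Function.uncurry, add_mul]
  rw [mellinT, setIntegral_congr_fun measurableSet_Ioi fun x hx => Gtrans_mul_cpow α g s hx,
    integral_const_mul, integral_integral_swap i3]
  congr 1
  rw [← integral_const_mul]
  refine integral_congr_ae (ae_of_all _ fun τ => ?_)
  beta_reduce
  rw [integral_mul_const, integral_besselKI_add_conj h0 hα h1, mul_assoc]

lemma continuous_Gamma_vertical {ν : ℝ} (hν : 0 < ν) :
    Continuous fun t : ℝ => Complex.Gamma (ν + t * Complex.I) := by
  rw [continuous_iff_continuousAt]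
  intro t
  have h : ContinuousAt Complex.Gamma (ν + t * Complex.I) := by
    refine (Complex.differentiableAt_Gamma _ fun m hm => ?_).continuousAt
    have := congrArg Complex.re hm
    have hm0 : (0 : ℝ) ≤ m := Nat.cast_nonneg m
    simp at this
    linarith
  exact ContinuousAt.comp (f := fun t : ℝ => (ν : ℂ) + t * Complex.I) h (by fun_prop)

lemma integrable_Gamma_vertical {ν : ℝ} (hν : 0 < ν) :
    Integrable fun t : ℝ => Complex.Gamma (ν + t * Complex.I) := by
  have hc : 0 < min 1 (ν ^ 2) := lt_min one_pos (by positivity)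
  have hdom := (integrable_inv_one_add_sq).const_mul (Real.Gamma (ν + 2) / min 1 (ν ^ 2))
  refine Integrable.mono' hdom (continuous_Gamma_vertical hν).aestronglyMeasurable
    (ae_of_all _ fun t => ?_)
  set s : ℂ := ν + t * Complex.I with hs
  have hre : s.re = ν := by simp [hs]
  have him : s.im = t := by simp [hs]
  have hs0 : s ≠ 0 := fun h => by rw [h] at hre; simp at hre; linarith
  have hs1 : s + 1 ≠ 0 := fun h => by
    have := congrArg Complex.re h
    simp [hre] at this
    linarith
  have e : Complex.Gamma (s + 1 + 1) = (s + 1) * (s * Complex.Gamma s) := by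
    rw [Complex.Gamma_add_one _ hs1, Complex.Gamma_add_one _ hs0]
  have hG : ‖Complex.Gamma (s + 1 + 1)‖ ≤ Real.Gamma (ν + 2) := by
    have := norm_Gamma_le_Gamma_re (z := s + 1 + 1) (by simp [hre]; linarith)
    rwa [show (s + 1 + 1).re = ν + 2 by simp [hre]; ring] at this
  rw [e, norm_mul, norm_mul] at hG
  have n0 : ν ^ 2 + t ^ 2 = ‖s‖ ^ 2 := by
    rw [← Complex.normSq_eq_norm_sq, Complex.normSq_apply, hre, him]; ring
  have n1 : ‖s‖ ≤ ‖s + 1‖ := by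
    rw [← sq_le_sq₀ (norm_nonneg _) (norm_nonneg _), ← Complex.normSq_eq_norm_sq,
      ← Complex.normSq_eq_norm_sq, Complex.normSq_apply, Complex.normSq_apply]
    simp only [Complex.add_re, Complex.one_re, Complex.add_im, Complex.one_im, hre, him]
    nlinarith
  have n2 : min 1 (ν ^ 2) * (1 + t ^ 2) ≤ ‖s‖ ^ 2 := by
    rw [← n0]
    nlinarith [min_le_left 1 (ν ^ 2), min_le_right 1 (ν ^ 2), sq_nonneg t]
  rw [← div_eq_mul_inv, div_div, le_div_iff₀ (by positivity)]
  refine le_trans ?_ hG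
  rw [mul_comm]
  calc min 1 (ν ^ 2) * (1 + t ^ 2) * ‖Complex.Gamma s‖
      ≤ ‖s‖ ^ 2 * ‖Complex.Gamma s‖ := by gcongr
    _ = ‖s‖ * (‖s‖ * ‖Complex.Gamma s‖) := by ring
    _ ≤ _ := by gcongr

lemma integral_Gamma_mul_cpow_neg {ν x : ℝ} (hν : 0 < ν) (hx : 0 < x) :
    ∫ t : ℝ, Complex.Gamma (ν + t * Complex.I) * (x : ℂ) ^ (-(ν + t * Complex.I)) =
      2 * Real.pi * Real.exp (-x) := by
  have hm : ∀ s : ℂ, 0 < s.re → mellin (fun x : ℝ => (Real.exp (-x) : ℂ)) s = Complex.Gamma s := by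
    intro s hs
    rw [Complex.Gamma_eq_integral hs, Complex.GammaIntegral, mellin]
    simp only [smul_eq_mul, mul_comm]
  have hmv : ∀ t : ℝ, mellin (fun x : ℝ => (Real.exp (-x) : ℂ)) (ν + t * Complex.I) =
      Complex.Gamma (ν + t * Complex.I) := fun t => hm _ (by simpa using hν)
  have h := mellinInv_mellin_eq ν (fun x : ℝ => (Real.exp (-x) : ℂ)) hx ?_ ?_ ?_
  · rw [mellinInv] at h
    simp only [hmv, smul_eq_mul] at h
    simp only [mul_comm (Complex.Gamma _)]
    rw [Complex.real_smul] at h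
    rw [← h, ← mul_assoc]
    push_cast
    rw [mul_one_div_cancel (by simp), one_mul]
  · have := Complex.GammaIntegral_convergent (s := ν) (by simpa using hν)
    rw [MellinConvergent]
    simpa only [smul_eq_mul, mul_comm] using this
  · rw [Complex.VerticalIntegrable]
    simp only [hmv]
    exact integrable_Gamma_vertical hν
  · fun_prop

lemma integral_cos_mul_exp_sinhSq (τ y : ℝ) :
    ∫ θ in Ioi (0 : ℝ), (Real.cos (τ * θ) : ℂ) * Real.exp (-(y * sinhSq θ)) =
      Real.exp (y / 2) * besselK (τ * Complex.I) (y / 2) := by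
  rw [besselK, ← integral_const_mul]
  congr 1
  ext θ
  have h : Real.cosh θ = 1 + 2 * sinhSq θ := by
    have h1 := Real.cosh_two_mul (θ / 2)
    have h2 := Real.cosh_sq (θ / 2)
    rw [mul_div_cancel₀ _ two_ne_zero] at h1
    rw [sinhSq]
    linarith
  rw [h, show (τ : ℂ) * Complex.I * θ = ((τ * θ : ℝ) : ℂ) * Complex.I by push_cast; ring,
    Complex.cosh_mul_I, ← Complex.ofReal_cos, ← mul_assoc, mul_comm]
  congr 1
  rw [Complex.ofReal_exp, Complex.ofReal_exp, ← Complex.exp_add]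
  congr 1
  push_cast
  ring

lemma integrableOn_sinhSq_rpow {ν : ℝ} (h0 : 0 < ν) (h1 : ν < 1 / 2) :
    IntegrableOn (fun θ => sinhSq θ ^ (-ν)) (Ioi 0) := by
  have h := ((integrableOn_kernel (s := ν) h0 h1 0).const_mul (4 ^ (ν : ℂ))).norm
  refine IntegrableOn.congr_fun h (fun θ hθ => ?_) measurableSet_Ioi
  have := sinhSq_cpow_neg hθ ν
  simp only [Complex.ofReal_zero, zero_mul, sub_zero]
  rw [← this, Complex.norm_cpow_eq_rpow_re_of_pos (sinhSq_pos hθ)]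
  simp

/-- The integrand of the triple integral, as a function of `t` and `(τ, θ)`. -/
noncomputable def tripleKernel (ν y : ℝ) (g : ℝ → ℝ) (t : ℝ) (p : ℝ × ℝ) : ℂ :=
  Complex.Gamma (ν + t * Complex.I) * ((y * sinhSq p.2 : ℝ) : ℂ) ^ (-(ν + t * Complex.I)) *
    ((Real.cos (p.1 * p.2) : ℂ) * coshWeight g p.1)

lemma integrable_triple_majorant {ν y : ℝ} (h0 : 0 < ν) (h1 : ν < 1 / 2) (hy : 0 < y) {g : ℝ → ℝ}
    (hg : Integrable g) : Integrable (fun p : ℝ × ℝ => |coshWeight g p.1| * (y * sinhSq p.2) ^ (-ν))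
      (volume.prod (volume.restrict (Ioi 0))) := by
  refine (integrable_coshWeight hg).abs.mul_prod
    (g := fun θ => (y * sinhSq θ) ^ (-ν)) (IntegrableOn.congr_fun
      ((integrableOn_sinhSq_rpow h0 h1).const_mul (y ^ (-ν))) (fun θ hθ => ?_) measurableSet_Ioi)
  exact (Real.mul_rpow hy.le (sinhSq_pos hθ).le).symm

lemma continuous_sinhSq : Continuous sinhSq := by
  unfold sinhSq
  fun_prop

lemma norm_tripleKernel_le (ν : ℝ) {y : ℝ} (hy : 0 < y) (g : ℝ → ℝ) (t : ℝ) {p : ℝ × ℝ}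
    (hp : 0 < p.2) : ‖tripleKernel ν y g t p‖ ≤ ‖Complex.Gamma (ν + t * Complex.I)‖ *
      (|coshWeight g p.1| * (y * sinhSq p.2) ^ (-ν)) := by
  have hq := mul_pos hy (sinhSq_pos hp)
  rw [tripleKernel, norm_mul, norm_mul, norm_mul, Complex.norm_real, Complex.norm_real,
    Complex.norm_cpow_eq_rpow_re_of_pos hq, Real.norm_eq_abs, Real.norm_eq_abs,
    show (-((ν : ℂ) + t * Complex.I)).re = -ν by simp]
  have hc := Real.abs_cos_le_one (p.1 * p.2)
  calc _ = ‖Complex.Gamma (ν + t * Complex.I)‖ *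
        (|coshWeight g p.1| * (y * sinhSq p.2) ^ (-ν)) * |Real.cos (p.1 * p.2)| := by ring
    _ ≤ _ := mul_le_of_le_one_right (by positivity) hc

lemma integrable_tripleKernel {ν y : ℝ} (h0 : 0 < ν) (h1 : ν < 1 / 2) (hy : 0 < y) {g : ℝ → ℝ}
    (hg : Integrable g) : Integrable (Function.uncurry (tripleKernel ν y g))
      (volume.prod (volume.prod (volume.restrict (Ioi 0)))) := by
  have hdom := (integrable_Gamma_vertical h0).norm.mul_prod
    (integrable_triple_majorant h0 h1 hy hg)
  refine Integrable.mono' hdom ?_ ?_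
  · have hG : AEStronglyMeasurable (fun q : ℝ × ℝ × ℝ => Complex.Gamma (ν + q.1 * Complex.I))
        (volume.prod (volume.prod (volume.restrict (Ioi 0)))) :=
      ((continuous_Gamma_vertical h0).comp continuous_fst).aestronglyMeasurable
    have hw : AEStronglyMeasurable (fun q : ℝ × ℝ × ℝ => (coshWeight g q.2.1 : ℂ))
        (volume.prod (volume.prod (volume.restrict (Ioi 0)))) :=
      (((integrable_coshWeight hg).ofReal (𝕜 := ℂ)).1.comp_fst).comp_snd
    have hs : Measurable sinhSq := continuous_sinhSq.measurable
    have hp : Measurable fun q : ℝ × ℝ × ℝ =>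
        ((y * sinhSq q.2.2 : ℝ) : ℂ) ^ (-((ν : ℂ) + q.1 * Complex.I)) := by fun_prop
    have hc : Measurable fun q : ℝ × ℝ × ℝ => (Real.cos (q.2.1 * q.2.2) : ℂ) := by fun_prop
    exact (hG.mul hp.aestronglyMeasurable).mul (hc.aestronglyMeasurable.mul hw)
  · have : ∀ᵐ p : ℝ × ℝ ∂(volume.prod (volume.restrict (Ioi 0))), p.2 ∈ Ioi (0 : ℝ) :=
      Measure.quasiMeasurePreserving_snd.ae (ae_restrict_mem measurableSet_Ioi)
    filter_upwards [Measure.quasiMeasurePreserving_snd.ae this] with q hq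
    exact norm_tripleKernel_le ν hy g q.1 hq

lemma integrable_tripleKernel_right {ν y : ℝ} (h0 : 0 < ν) (h1 : ν < 1 / 2) (hy : 0 < y)
    {g : ℝ → ℝ} (hg : Integrable g) (t : ℝ) : Integrable (tripleKernel ν y g t)
      (volume.prod (volume.restrict (Ioi 0))) := by
  refine Integrable.mono' ((integrable_triple_majorant h0 h1 hy hg).const_mul
    ‖Complex.Gamma (ν + t * Complex.I)‖) ?_ ?_
  · have hw : AEStronglyMeasurable (fun q : ℝ × ℝ => (coshWeight g q.1 : ℂ))
        (volume.prod (volume.restrict (Ioi 0))) :=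
      ((integrable_coshWeight hg).ofReal (𝕜 := ℂ)).1.comp_fst
    have hs : Measurable sinhSq := continuous_sinhSq.measurable
    have hp : Measurable fun q : ℝ × ℝ => Complex.Gamma (ν + t * Complex.I) *
        ((y * sinhSq q.2 : ℝ) : ℂ) ^ (-((ν : ℂ) + t * Complex.I)) := by fun_prop
    have hc : Measurable fun q : ℝ × ℝ => (Real.cos (q.1 * q.2) : ℂ) := by fun_prop
    exact hp.aestronglyMeasurable.mul (hc.aestronglyMeasurable.mul hw)
  · have : ∀ᵐ p : ℝ × ℝ ∂(volume.prod (volume.restrict (Ioi 0))), p.2 ∈ Ioi (0 : ℝ) :=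
      Measure.quasiMeasurePreserving_snd.ae (ae_restrict_mem measurableSet_Ioi)
    filter_upwards [this] with q hq
    exact norm_tripleKernel_le ν hy g t hq

lemma inversion_integrand {α ν y : ℝ} (h0 : 0 < ν) (hα : -α < ν) (h1 : ν < 1 / 2) (hy : 0 < y)
    {g : ℝ → ℝ} (hg : Integrable g) (t : ℝ) :
    (fun s : ℂ => Complex.Gamma s * Complex.Gamma (1 + α - s) / Complex.Gamma (s + α) *
      mellinT (Gtrans α g) s * (y : ℂ) ^ (-s)) ((ν : ℂ) + t * Complex.I) =
    Real.sqrt Real.pi *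
      ∫ p, tripleKernel ν y g t p ∂(volume.prod (volume.restrict (Ioi 0))) := by
  have hre : ((ν : ℂ) + t * Complex.I).re = ν := by simp
  rw [integral_prod _ (integrable_tripleKernel_right h0 h1 hy hg t)]
  simp only [tripleKernel]
  generalize (ν : ℂ) + t * Complex.I = s at hre ⊢
  rw [mellinT_Gtrans (by rwa [hre]) (by rwa [hre]) (by rwa [hre]) hg]
  have g1 : Complex.Gamma (s + α) ≠ 0 := Complex.Gamma_ne_zero_of_re_pos (by simp [hre]; linarith)
  have g2 : Complex.Gamma (1 + α - s) ≠ 0 :=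
    Complex.Gamma_ne_zero_of_re_pos (by simp [hre]; linarith)
  have e : ∀ τ : ℝ, ∫ θ in Ioi (0 : ℝ), Complex.Gamma s * ((y * sinhSq θ : ℝ) : ℂ) ^ (-s) *
      ((Real.cos (τ * θ) : ℂ) * coshWeight g τ) = Complex.Gamma s * (y : ℂ) ^ (-s) *
      ((∫ θ in Ioi (0 : ℝ), (Real.cos (τ * θ) : ℂ) * (sinhSq θ : ℂ) ^ (-s)) *
        coshWeight g τ) := by
    intro τ
    rw [← integral_mul_const, ← integral_const_mul]
    refine setIntegral_congr_fun measurableSet_Ioi fun θ hθ => ?_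
    rw [Complex.ofReal_mul, Complex.mul_cpow_ofReal_nonneg hy.le (sinhSq_pos hθ).le]
    ring
  simp only [e]
  rw [integral_const_mul]
  field_simp

lemma integral_tripleKernel {ν y : ℝ} (h0 : 0 < ν) (hy : 0 < y) (g : ℝ → ℝ) {p : ℝ × ℝ}
    (hp : 0 < p.2) : ∫ t, tripleKernel ν y g t p = 2 * Real.pi *
      ((Real.cos (p.1 * p.2) : ℂ) * Real.exp (-(y * sinhSq p.2)) * coshWeight g p.1) := by
  simp only [tripleKernel]
  rw [integral_mul_const, integral_Gamma_mul_cpow_neg h0 (mul_pos hy (sinhSq_pos hp))]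
  ring

lemma integral_integral_tripleKernel {ν y : ℝ} (h0 : 0 < ν) (h1 : ν < 1 / 2) (hy : 0 < y)
    {g : ℝ → ℝ} (hg : Integrable g) :
    ∫ t, ∫ p, tripleKernel ν y g t p ∂(volume.prod (volume.restrict (Ioi 0))) =
      2 * Real.pi * ∫ τ : ℝ, ((Real.exp (y / 2) * g τ / Real.cosh (Real.pi * τ) : ℝ) : ℂ) *
          besselK (τ * Complex.I) (y / 2) := by
  have hFint := integrable_tripleKernel h0 h1 hy hg
  have hmem : ∀ᵐ p : ℝ × ℝ ∂(volume.prod (volume.restrict (Ioi 0))), p.2 ∈ Ioi (0 : ℝ) :=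
    Measure.quasiMeasurePreserving_snd.ae (ae_restrict_mem measurableSet_Ioi)
  have hae : (fun p => ∫ t, tripleKernel ν y g t p)
      =ᵐ[volume.prod (volume.restrict (Ioi 0))] fun p => 2 * Real.pi *
      ((Real.cos (p.1 * p.2) : ℂ) * Real.exp (-(y * sinhSq p.2)) * coshWeight g p.1) := by
    filter_upwards [hmem] with p hp using integral_tripleKernel h0 hy g hp
  have hI := hFint.integral_prod_right.congr hae
  rw [integral_integral_swap hFint, integral_congr_ae hae, integral_prod _ hI,
    ← integral_const_mul]
  refine integral_congr_ae (ae_of_all _ fun τ => ?_)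
  dsimp only
  rw [integral_const_mul, integral_mul_const, integral_cos_mul_exp_sinhSq, coshWeight]
  push_cast
  ring

end

/-- Theorem 3, second part: for `α > −1/4`, `g ∈ L₁(ℝ)` and
`G_α g ∈ L_{ν,1}((0,1))` with `max(−α,0) < ν < 1/2`, for all `y > 0`
(`s = ν + it`, `ds = i dt` along the contour)
`(1/2πi) ∫ [Γ(s)Γ(1+α−s)/Γ(s+α)] (G_α g)*(s) y^{−s} ds
  = √π ∫_ℝ e^{y/2} K_{iτ}(y/2) g(τ)/cosh(πτ) dτ`. -/
theorem statement5 (α ν : ℝ) (hα : α > -1/4) (hν : max (-α) 0 < ν ∧ ν < 1/2)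
    (g : ℝ → ℝ) (hmeas : MeasureTheory.AEStronglyMeasurable g MeasureTheory.volume)
    (hg : MeasureTheory.Integrable g)
    (hGν : MeasureTheory.IntegrableOn
      (fun x : ℝ => |Gtrans α g x| * x ^ (ν - 1)) (Set.Ioo 0 1)) :
    ∀ y : ℝ, 0 < y →
      (1 / (2 * (Real.pi : ℂ))) *
        ∫ t : ℝ, (fun s : ℂ =>
          Complex.Gamma s * Complex.Gamma (1 + α - s) / Complex.Gamma (s + α) *
            mellinT (Gtrans α g) s * (y : ℂ) ^ (-s)) ((ν : ℂ) + t * Complex.I) =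
      (Real.sqrt Real.pi : ℂ) *
        ∫ τ : ℝ, ((Real.exp (y / 2) * g τ / Real.cosh (Real.pi * τ) : ℝ) : ℂ) *
          besselK (τ * Complex.I) (y / 2) := by
  intro y hy
  have h0 : 0 < ν := (le_max_right _ _).trans_lt hν.1
  have hαν : -α < ν := (le_max_left _ _).trans_lt hν.1
  rw [MeasureTheory.integral_congr_ae
    (Filter.Eventually.of_forall fun t => inversion_integrand h0 hαν hν.2 hy hg t),
    MeasureTheory.integral_const_mul, integral_integral_tripleKernel h0 hν.2 hy hg]
  rw [mul_left_comm, ← mul_assoc (1 / _), one_div_mul_cancel (by simp), one_mul]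
end

section
/- Let α ∈ ℝ and γ with max(−α, 0) < γ < 1/2. Then there exists a constant C > 0 such that for all x > 0 and all τ ∈ ℝ, |Φ_{α,τ}(x)| ≤ C x^{−γ}, where C is independent of x and τ. -/
/-- The kernel `Φ_{α,τ}(x) = (2√π / cosh(πτ)) · Re[K_{α+iτ}(√x) I_{α−iτ}(√x)]`. -/
noncomputable def PhiKer (α τ : ℝ) (x : ℝ) : ℝ :=
  (2 * Real.sqrt Real.pi / Real.cosh (Real.pi * τ)) *
    (besselK (α + τ * Complex.I) (Real.sqrt x) *
      besselI (α - τ * Complex.I) (Real.sqrt x)).re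

theorem one_le_cosh_mul_norm_Gamma_half (τ : ℝ) :
    1 ≤ Real.cosh (Real.pi * τ) * ‖Complex.Gamma (1 / 2 + τ * Complex.I)‖ := by
  have hconj : 1 - (1 / 2 + τ * Complex.I : ℂ) =
      (starRingEnd ℂ) (1 / 2 + τ * Complex.I) := by
    apply Complex.ext <;> simp; norm_num
  have h := Complex.Gamma_mul_Gamma_one_sub (1 / 2 + τ * Complex.I)
  have hsin : Complex.sin (Real.pi * (1 / 2 + τ * Complex.I)) =
      (Real.cosh (Real.pi * τ) : ℂ) := by
    have : (Real.pi * (1 / 2 + τ * Complex.I) : ℂ) =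
        (Real.pi * τ : ℂ) * Complex.I + Real.pi / 2 := by ring
    rw [this, Complex.sin_add_pi_div_two, Complex.cos_mul_I]
    push_cast
    rfl
  rw [hsin, hconj, Complex.Gamma_conj] at h
  have hn := congrArg norm h
  have hc := Real.one_le_cosh (Real.pi * τ)
  rw [norm_mul, RCLike.norm_conj, norm_div, Complex.norm_real, Complex.norm_real,
    Real.norm_of_nonneg Real.pi_pos.le, Real.norm_of_nonneg (by linarith),
    eq_div_iff (by linarith)] at hn
  set g := ‖Complex.Gamma (1 / 2 + τ * Complex.I)‖
  set c := Real.cosh (Real.pi * τ)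
  have hg : 0 ≤ g := norm_nonneg _
  have hπ := Real.pi_gt_three
  have : 1 ≤ (c * g) ^ 2 := by
    have : (c * g) ^ 2 = c * Real.pi := by rw [← hn]; ring
    rw [this]
    nlinarith
  nlinarith [mul_nonneg (by linarith : 0 ≤ c) hg]

theorem exists_one_le_mul_cosh_mul_norm_Gamma {σ : ℝ} (hσ : 1 / 2 < σ) :
    ∃ M : ℝ, 0 ≤ M ∧ ∀ τ : ℝ,
      1 ≤ M * Real.cosh (Real.pi * τ) * ‖Complex.Gamma (σ + τ * Complex.I)‖ := by
  obtain ⟨β, rfl⟩ : ∃ β : ℝ, σ = 1 / 2 + β := ⟨σ - 1 / 2, by ring⟩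
  have hβ : 0 < β := by linarith
  set g : ℝ → ℝ := fun x => ‖(x : ℂ) ^ ((1 / 2 : ℂ) - 1) * (1 - (x : ℂ)) ^ ((β : ℂ) - 1)‖
    with hg
  have hgi : IntervalIntegrable g MeasureTheory.volume 0 1 :=
    (Complex.betaIntegral_convergent (by norm_num) (by simpa using hβ)).norm
  have hB : ∀ τ : ℝ, ‖Complex.betaIntegral (1 / 2 + τ * Complex.I) β‖ ≤ ∫ x in (0 : ℝ)..1, g x := by
    intro τ
    apply intervalIntegral.norm_integral_le_of_norm_le zero_le_one _ hgi
    refine Filter.Eventually.of_forall fun x hx => le_of_eq ?_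
    simp only [hg, norm_mul]
    rw [Complex.norm_cpow_eq_rpow_re_of_pos hx.1, Complex.norm_cpow_eq_rpow_re_of_pos hx.1]
    simp
  have hΓ : 0 < ‖Complex.Gamma β‖ :=
    norm_pos_iff.2 (Complex.Gamma_ne_zero_of_re_pos (by simpa using hβ))
  have hM : 0 ≤ ∫ x in (0 : ℝ)..1, g x := (norm_nonneg _).trans (hB 0)
  refine ⟨(∫ x in (0 : ℝ)..1, g x) / ‖Complex.Gamma β‖, by positivity, fun τ => ?_⟩
  have h := Complex.Gamma_mul_Gamma_eq_betaIntegral (s := 1 / 2 + τ * Complex.I) (t := β)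
    (by simp) (by simpa using hβ)
  have e : (1 / 2 + τ * Complex.I + β : ℂ) = ((1 / 2 + β : ℝ) : ℂ) + τ * Complex.I := by
    push_cast; ring
  have hn := congrArg norm h
  rw [e, norm_mul, norm_mul] at hn
  have h1 := one_le_cosh_mul_norm_Gamma_half τ
  have hc := Real.one_le_cosh (Real.pi * τ)
  calc (1 : ℝ) ≤ Real.cosh (Real.pi * τ) * ‖Complex.Gamma (1 / 2 + τ * Complex.I)‖ := h1
    _ = Real.cosh (Real.pi * τ) * (‖Complex.Gamma (((1 / 2 + β : ℝ) : ℂ) + τ * Complex.I)‖ *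
          ‖Complex.betaIntegral (1 / 2 + τ * Complex.I) β‖ / ‖Complex.Gamma β‖) := by
        rw [← hn]; field_simp
    _ ≤ Real.cosh (Real.pi * τ) * (‖Complex.Gamma (((1 / 2 + β : ℝ) : ℂ) + τ * Complex.I)‖ *
          (∫ x in (0 : ℝ)..1, g x) / ‖Complex.Gamma β‖) := by
        gcongr
        exact hB τ
    _ = _ := by ring

theorem Real.exp_neg_le_mul_rpow_neg {p y : ℝ} (hp : 0 < p) (hy : 0 < y) :
    Real.exp (-y) ≤ p ^ p * y ^ (-p) := by
  have h1 : y / p ≤ Real.exp (y / p) := by linarith [Real.add_one_le_exp (y / p)]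
  have h2 : (y / p) ^ p ≤ Real.exp y := by
    calc (y / p) ^ p ≤ Real.exp (y / p) ^ p := by gcongr
      _ = Real.exp y := by rw [← Real.exp_mul]; congr 1; field_simp
  rw [Real.div_rpow hy.le hp.le, div_le_iff₀ (by positivity)] at h2
  rw [Real.exp_neg, Real.rpow_neg hy.le, ← div_eq_mul_inv, inv_eq_one_div,
    div_le_div_iff₀ (Real.exp_pos _) (by positivity)]
  linarith

theorem Complex.norm_cosh_le (w : ℂ) : ‖Complex.cosh w‖ ≤ Real.cosh w.re := by
  rw [Complex.cosh, norm_div, Real.cosh_eq]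
  have := norm_add_le (Complex.exp w) (Complex.exp (-w))
  rw [Complex.norm_exp, Complex.norm_exp, Complex.neg_re] at this
  rw [Complex.norm_ofNat]
  gcongr

theorem Real.sq_div_two_le_cosh_sub_one {t : ℝ} : t ^ 2 / 2 ≤ Real.cosh t - 1 := by
  have h := sum_le_hasSum (Finset.range 2) (fun i _ => by rw [pow_mul]; positivity) (Real.hasSum_cosh t)
  simp [Finset.sum_range_succ] at h
  linarith

theorem Real.exp_div_ten_le_cosh_sub_one {t : ℝ} (ht : 1 ≤ t) :
    Real.exp t / 10 ≤ Real.cosh t - 1 := by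
  have h1 : Real.exp 1 ≤ Real.exp t := by gcongr
  have := Real.exp_one_gt_d9
  have := Real.exp_pos (-t)
  rw [Real.cosh_eq]
  linarith

theorem Real.cosh_le_exp_abs (t : ℝ) : Real.cosh t ≤ Real.exp |t| := by
  rw [Real.cosh_eq]
  have h1 : Real.exp t ≤ Real.exp |t| := by gcongr; exact le_abs_self t
  have h2 : Real.exp (-t) ≤ Real.exp |t| := by gcongr; exact neg_le_abs t
  linarith

/-- Bound for `K` combining the small and the large argument behaviour. -/
theorem exists_norm_besselK_le {α p q : ℝ} (hp : 0 < p) (hp' : p < 1 / 2) (hq : |α| < q) :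
    ∃ C : ℝ, 0 ≤ C ∧ ∀ z : ℝ, 0 < z → ∀ τ : ℝ,
      ‖besselK (α + τ * Complex.I) z‖ ≤ C * (Real.exp (-z) * (z ^ (-p) + z ^ (-q))) := by
  have hq0 : 0 < q := (abs_nonneg α).trans_lt hq
  set f₁ : ℝ → ℝ := (Set.Ioc (0 : ℝ) 1).indicator fun t => t ^ (-(2 * p)) with hf₁
  set f₂ : ℝ → ℝ := fun t => Real.exp (-(q - |α|) * t) with hf₂
  have hi₁ : MeasureTheory.Integrable f₁ (MeasureTheory.volume.restrict (Set.Ioi 0)) := by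
    have : MeasureTheory.IntegrableOn (fun t : ℝ => t ^ (-(2 * p))) (Set.Ioc 0 1) := by
      rw [← intervalIntegrable_iff_integrableOn_Ioc_of_le zero_le_one]
      exact intervalIntegral.intervalIntegrable_rpow' (by linarith)
    exact ((MeasureTheory.integrable_indicator_iff measurableSet_Ioc).2 this).restrict
  have hi₂ : MeasureTheory.Integrable f₂ (MeasureTheory.volume.restrict (Set.Ioi 0)) :=
    exp_neg_integrableOn_Ioi 0 (by linarith)
  have hn₁ : ∀ t, 0 ≤ f₁ t := fun t => Set.indicator_nonneg
    (fun t ht => Real.rpow_nonneg ht.1.le _) t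
  have hn₂ : ∀ t, 0 ≤ f₂ t := fun t => (Real.exp_pos _).le
  set A : ℝ := p ^ p * 2 ^ p * Real.cosh α
  set B : ℝ := q ^ q * 10 ^ q
  have hA : 0 ≤ A := by have := Real.cosh_pos α; positivity
  have hB : 0 ≤ B := by positivity
  set J₁ := ∫ t in Set.Ioi 0, f₁ t
  set J₂ := ∫ t in Set.Ioi 0, f₂ t
  have hJ₁ : 0 ≤ J₁ := MeasureTheory.integral_nonneg hn₁
  have hJ₂ : 0 ≤ J₂ := MeasureTheory.integral_nonneg hn₂
  refine ⟨A * J₁ + B * J₂, by positivity, fun z hz τ => ?_⟩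
  have key : ‖besselK (α + τ * Complex.I) z‖ ≤
      ∫ t in Set.Ioi 0, (Real.exp (-z) * z ^ (-p) * A * f₁ t +
        Real.exp (-z) * z ^ (-q) * B * f₂ t) := by
    apply MeasureTheory.norm_integral_le_of_norm_le ((hi₁.const_mul _).add (hi₂.const_mul _))
    refine (MeasureTheory.ae_restrict_mem measurableSet_Ioi).mono fun t (ht : 0 < t) => ?_
    have e1 : ‖Complex.exp (-(z : ℂ) * Real.cosh t)‖ =
        Real.exp (-z) * Real.exp (-(z * (Real.cosh t - 1))) := by
      rw [Complex.norm_exp, ← Real.exp_add, ← Complex.ofReal_neg, ← Complex.ofReal_mul,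
        Complex.ofReal_re]
      congr 1
      ring
    have e2 : ‖Complex.cosh ((α + τ * Complex.I) * t)‖ ≤ Real.cosh (α * t) := by
      refine (Complex.norm_cosh_le _).trans (le_of_eq ?_)
      simp
    rw [norm_mul, e1]
    have hz1 := Real.exp_pos (-z)
    rcases le_or_gt t 1 with h1 | h1
    · have e3 : f₁ t = t ^ (-(2 * p)) := Set.indicator_of_mem (Set.mem_Ioc.2 ⟨ht, h1⟩) _
      have e4 : Real.exp (-(z * (Real.cosh t - 1))) ≤ p ^ p * (z ^ (-p) * (2 ^ p * f₁ t)) := by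
        calc Real.exp (-(z * (Real.cosh t - 1))) ≤ Real.exp (-(z * (t ^ 2 / 2))) := by
              gcongr
              exact Real.sq_div_two_le_cosh_sub_one
          _ ≤ p ^ p * (z * (t ^ 2 / 2)) ^ (-p) := Real.exp_neg_le_mul_rpow_neg hp (by positivity)
          _ = _ := by
            rw [e3, Real.mul_rpow hz.le (by positivity), Real.div_rpow (by positivity) (by norm_num),
              Real.rpow_neg (by norm_num : (0 : ℝ) ≤ 2), div_inv_eq_mul, ← Real.rpow_natCast,
              ← Real.rpow_mul ht.le]
            push_cast
            rw [mul_neg, mul_comm (2 ^ p)]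
      have e5 : Real.cosh (α * t) ≤ Real.cosh α := by
        rw [Real.cosh_le_cosh, abs_mul, abs_of_pos ht]
        exact mul_le_of_le_one_right (abs_nonneg _) h1
      have e6 : 0 ≤ Real.exp (-z) * z ^ (-q) * B * f₂ t := by
        have := hn₂ t
        positivity
      have := hn₁ t
      calc _ ≤ Real.exp (-z) * (p ^ p * (z ^ (-p) * (2 ^ p * f₁ t))) * Real.cosh α := by
            gcongr
            exact e2.trans e5
        _ = Real.exp (-z) * z ^ (-p) * A * f₁ t := by ring
        _ ≤ _ := le_add_of_nonneg_right e6
    · have e4 : Real.exp (-(z * (Real.cosh t - 1))) ≤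
          q ^ q * (z ^ (-q) * (Real.exp (-(q * t)) * 10 ^ q)) := by
        calc Real.exp (-(z * (Real.cosh t - 1))) ≤ Real.exp (-(z * (Real.exp t / 10))) := by
              gcongr
              exact Real.exp_div_ten_le_cosh_sub_one h1.le
          _ ≤ q ^ q * (z * (Real.exp t / 10)) ^ (-q) := Real.exp_neg_le_mul_rpow_neg hq0 (by positivity)
          _ = _ := by
            rw [Real.mul_rpow hz.le (by positivity), Real.div_rpow (by positivity) (by norm_num),
              Real.rpow_neg (by norm_num : (0 : ℝ) ≤ 10), div_inv_eq_mul, ← Real.exp_mul,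
              mul_neg, mul_comm t q]
      have e5 : Real.cosh (α * t) ≤ Real.exp (|α| * t) := by
        refine (Real.cosh_le_exp_abs _).trans (le_of_eq ?_)
        rw [abs_mul, abs_of_pos ht]
      have e6 : 0 ≤ Real.exp (-z) * z ^ (-p) * A * f₁ t := by
        have := hn₁ t
        positivity
      have e7 : Real.exp (-(q * t)) * Real.exp (|α| * t) = f₂ t := by
        rw [← Real.exp_add, hf₂]
        congr 1
        ring
      calc _ ≤ Real.exp (-z) * (q ^ q * (z ^ (-q) * (Real.exp (-(q * t)) * 10 ^ q))) *
              Real.exp (|α| * t) := by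
            gcongr
            exact e2.trans e5
        _ = Real.exp (-z) * z ^ (-q) * B * (Real.exp (-(q * t)) * Real.exp (|α| * t)) := by ring
        _ ≤ _ := by rw [e7]; exact le_add_of_nonneg_left e6
  rw [MeasureTheory.integral_add (hi₁.const_mul _) (hi₂.const_mul _),
    MeasureTheory.integral_const_mul, MeasureTheory.integral_const_mul] at key
  have hz1 := Real.exp_pos (-z)
  have hzp : 0 ≤ z ^ (-p) := by positivity
  have hzq : 0 ≤ z ^ (-q) := by positivity
  refine key.trans (sub_nonneg.1 ?_)
  have : 0 ≤ Real.exp (-z) * (A * J₁ * z ^ (-q) + B * J₂ * z ^ (-p)) := by positivity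
  refine this.trans (le_of_eq ?_)
  ring

theorem Complex.norm_Gamma_mul_prod_le {s : ℂ} (hs : 0 < s.re) (k : ℕ) :
    ‖Complex.Gamma s‖ * ∏ j ∈ Finset.range k, (s.re + j) ≤ ‖Complex.Gamma (s + k)‖ := by
  induction k with
  | zero => simp
  | succ k ih =>
    have hre : (s + k).re = s.re + k := by simp
    have hpos : 0 < (s + k).re := by rw [hre]; positivity
    have hne : s + k ≠ 0 := fun h => by simp [h] at hpos
    rw [Finset.prod_range_succ, Nat.cast_add, Nat.cast_one, ← add_assoc,
      Complex.Gamma_add_one _ hne, norm_mul, ← mul_assoc, mul_comm]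
    have h1 : s.re + k ≤ ‖s + k‖ := hre ▸ Complex.re_le_norm _
    gcongr

/-- The denominators `k! (a)(a+1)⋯(a+k-1)` of the power series of `I`. -/
noncomputable def besselDenom (a : ℝ) (k : ℕ) : ℝ :=
  (Nat.factorial k : ℝ) * ∏ j ∈ Finset.range k, (a + j)

theorem add_one_rpow_mul_le {β s : ℝ} (hβ : 0 ≤ β) (hs : 0 < s) :
    (s + β + 1) ^ β * s ≤ (s + β) ^ β * (s + β) := by
  have hu : 0 < s + β := by linarith
  have h1 : (s + β + 1) ^ β ≤ (s + β) ^ β * Real.exp (β / (s + β)) := by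
    have e : s + β + 1 = (s + β) * (1 + 1 / (s + β)) := by field_simp
    rw [e, Real.mul_rpow hu.le (by positivity)]
    gcongr
    calc (1 + 1 / (s + β)) ^ β ≤ Real.exp (1 / (s + β)) ^ β := by
          gcongr
          linarith [Real.add_one_le_exp (1 / (s + β))]
      _ = _ := by rw [← Real.exp_mul]; congr 1; ring
  have h2 : Real.exp (β / (s + β)) * s ≤ s + β := by
    have h3 := Real.add_one_le_exp (-(β / (s + β)))
    have h4 : -(β / (s + β)) + 1 = s / (s + β) := by field_simp; ring
    rw [h4, Real.exp_neg, div_le_iff₀ hu] at h3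
    have h5 := Real.exp_pos (β / (s + β))
    calc _ ≤ Real.exp (β / (s + β)) * ((Real.exp (β / (s + β)))⁻¹ * (s + β)) := by gcongr
      _ = s + β := by field_simp
  calc _ ≤ (s + β) ^ β * Real.exp (β / (s + β)) * s := by gcongr
    _ = (s + β) ^ β * (Real.exp (β / (s + β)) * s) := by ring
    _ ≤ _ := by gcongr

theorem rpow_mul_factorial_le_besselDenom {a : ℝ} (ha : 1 / 2 ≤ a) (k : ℕ) :
    (a + k) ^ (a - 1 / 2) * ((2 * k).factorial / 4 ^ k) ≤
      a ^ (a - 1 / 2) * besselDenom a k := by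
  induction k with
  | zero => simp [besselDenom]
  | succ k ih =>
    have e1 : ((2 * (k + 1)).factorial : ℝ) / 4 ^ (k + 1) =
        (2 * k).factorial / 4 ^ k * ((k + 1) * (k + 1 / 2)) := by
      rw [show 2 * (k + 1) = 2 * k + 1 + 1 by ring, Nat.factorial_succ, Nat.factorial_succ]
      push_cast
      field_simp
      ring
    have e2 : besselDenom a (k + 1) = besselDenom a k * ((k + 1) * (a + k)) := by
      simp only [besselDenom, Nat.factorial_succ, Finset.prod_range_succ]
      push_cast
      ring
    have h := add_one_rpow_mul_le (β := a - 1 / 2) (s := k + 1 / 2) (by linarith) (by positivity)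
    have e3 : (k : ℝ) + 1 / 2 + (a - 1 / 2) = a + k := by ring
    rw [e3] at h
    rw [e1, e2]
    push_cast
    have hak : 0 ≤ a + k := by positivity
    calc _ = ((a + k + 1) ^ (a - 1 / 2) * (k + 1 / 2)) *
          ((2 * k).factorial / 4 ^ k * (k + 1)) := by rw [add_assoc a]; ring
      _ ≤ ((a + k) ^ (a - 1 / 2) * (a + k)) * ((2 * k).factorial / 4 ^ k * (k + 1)) := by gcongr
      _ = ((a + k) ^ (a - 1 / 2) * ((2 * k).factorial / 4 ^ k)) * ((k + 1) * (a + k)) := by ring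
      _ ≤ (a ^ (a - 1 / 2) * besselDenom a k) * ((k + 1) * (a + k)) := by gcongr
      _ = _ := by ring

theorem besselDenom_pos {a : ℝ} (ha : 0 < a) (k : ℕ) : 0 < besselDenom a k :=
  mul_pos (by positivity) (Finset.prod_pos fun _ _ => by positivity)

theorem div_besselDenom_le {a z : ℝ} (ha : 1 / 2 ≤ a) (k : ℕ) :
    (z / 2) ^ (2 * k) / besselDenom a k ≤
      (a / (a + k)) ^ (a - 1 / 2) * (z ^ (2 * k) / (2 * k).factorial) := by
  have ha0 : 0 < a := by linarith
  have hD := besselDenom_pos ha0 k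
  have h := rpow_mul_factorial_le_besselDenom ha k
  have e : (z / 2) ^ (2 * k) = z ^ (2 * k) / 4 ^ k := by
    rw [div_pow, pow_mul 2]; norm_num
  have hz : 0 ≤ z ^ (2 * k) := by rw [pow_mul]; positivity
  rw [e, Real.div_rpow ha0.le (by positivity), div_mul_div_comm, div_div,
    div_le_div_iff₀ (by positivity) (by positivity)]
  calc _ = z ^ (2 * k) * ((a + k) ^ (a - 1 / 2) * ((2 * k).factorial / 4 ^ k)) * 4 ^ k := by
        field_simp
    _ ≤ z ^ (2 * k) * (a ^ (a - 1 / 2) * besselDenom a k) * 4 ^ k := by gcongr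
    _ = _ := by ring

theorem div_besselDenom_le_div_factorial {a z : ℝ} (ha : 1 / 2 ≤ a) (k : ℕ) :
    (z / 2) ^ (2 * k) / besselDenom a k ≤ z ^ (2 * k) / (2 * k).factorial := by
  have hz : 0 ≤ z ^ (2 * k) := by rw [pow_mul]; positivity
  refine (div_besselDenom_le ha k).trans (mul_le_of_le_one_left (by positivity) ?_)
  have ha0 : 0 < a := by linarith
  apply Real.rpow_le_one (by positivity) _ (by linarith)
  rw [div_le_one (by positivity)]
  linarith [(Nat.cast_nonneg k : (0 : ℝ) ≤ k)]

theorem summable_div_besselDenom {a : ℝ} (ha : 1 / 2 ≤ a) (z : ℝ) :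
    Summable fun k : ℕ => (z / 2) ^ (2 * k) / besselDenom a k := by
  refine Summable.of_nonneg_of_le (fun k => ?_) (div_besselDenom_le_div_factorial ha)
    (Real.hasSum_cosh z).summable
  have := besselDenom_pos (by linarith : 0 < a) k
  rw [pow_mul]
  positivity

theorem tsum_div_besselDenom_le_exp {a z : ℝ} (ha : 1 / 2 ≤ a) (hz : 0 ≤ z) :
    ∑' k : ℕ, (z / 2) ^ (2 * k) / besselDenom a k ≤ Real.exp z := by
  calc _ ≤ Real.cosh z :=
        hasSum_le (div_besselDenom_le_div_factorial ha)
          (summable_div_besselDenom ha z).hasSum (Real.hasSum_cosh z)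
    _ ≤ Real.exp z := by simpa [abs_of_nonneg hz] using Real.cosh_le_exp_abs z

theorem summable_and_tsum_two_mul_add_le_exp {z : ℝ} (hz : 0 ≤ z) (n : ℕ) :
    Summable (fun k : ℕ => z ^ (2 * k + n) / (2 * k + n).factorial) ∧
      ∑' k : ℕ, z ^ (2 * k + n) / (2 * k + n).factorial ≤ Real.exp z := by
  have hinj : Function.Injective fun k : ℕ => 2 * k + n := fun i j h => by
    simp only at h; omega
  have hs := Real.summable_pow_div_factorial z
  have he : ∑' m : ℕ, z ^ m / m.factorial = Real.exp z := by
    rw [Real.exp_eq_exp_ℝ, NormedSpace.exp_eq_tsum_div]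
  exact ⟨hs.comp_injective hinj, he ▸ tsum_comp_le_tsum_of_inj hs (fun m => by positivity) hinj⟩

theorem Nat.factorial_two_mul_add_le {a : ℝ} (ha : 1 / 2 ≤ a) (n k : ℕ) :
    ((2 * k + n).factorial : ℝ) ≤ (2 * k).factorial * ((2 + 2 * n) * (a + k)) ^ n := by
  rw [← Nat.factorial_mul_ascFactorial]
  push_cast
  have h1 : (((2 * k + 1).ascFactorial n : ℕ) : ℝ) ≤ ((2 * k + n : ℕ) : ℝ) ^ n := by
    exact_mod_cast Nat.ascFactorial_le_pow_add (2 * k) n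
  gcongr
  refine h1.trans ?_
  gcongr
  push_cast
  have hk : (0 : ℝ) ≤ k := Nat.cast_nonneg k
  have hn : (0 : ℝ) ≤ n := Nat.cast_nonneg n
  nlinarith [mul_nonneg hk hn, mul_nonneg hn (by linarith : 0 ≤ a - 1 / 2)]

theorem Real.rpow_le_one_add_pow {y p : ℝ} {n : ℕ} (hy : 0 ≤ y) (hp : 0 ≤ p) (hn : p ≤ n) :
    y ^ p ≤ 1 + y ^ n := by
  rcases le_total y 1 with h | h
  · have := Real.rpow_le_one hy h hp
    have := pow_nonneg hy n
    linarith
  · have := Real.rpow_le_rpow_of_exponent_le h hn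
    rw [Real.rpow_natCast] at this
    linarith

theorem exists_rpow_mul_tsum_le {a : ℝ} (ha : 1 / 2 ≤ a) :
    ∃ C : ℝ, 0 ≤ C ∧ ∀ z : ℝ, 0 < z →
      z ^ (a - 1 / 2) * ∑' k : ℕ, (z / 2) ^ (2 * k) / besselDenom a k ≤ C * Real.exp z := by
  have ha0 : 0 < a := by linarith
  have hβ : 0 ≤ a - 1 / 2 := by linarith
  obtain ⟨n, hn⟩ := exists_nat_ge (a - 1 / 2)
  refine ⟨a ^ (a - 1 / 2) * (1 + (2 + 2 * n) ^ n), by positivity, fun z hz => ?_⟩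
  obtain ⟨hs0, hb0⟩ := summable_and_tsum_two_mul_add_le_exp hz.le 0
  obtain ⟨hs, hb⟩ := summable_and_tsum_two_mul_add_le_exp hz.le n
  simp only [add_zero] at hs0 hb0
  have hterm : ∀ k : ℕ, z ^ (a - 1 / 2) * ((z / 2) ^ (2 * k) / besselDenom a k) ≤
      a ^ (a - 1 / 2) * (z ^ (2 * k) / (2 * k).factorial +
        (2 + 2 * n) ^ n * (z ^ (2 * k + n) / (2 * k + n).factorial)) := by
    intro k
    have hak : 0 < a + k := by positivity
    have h1 := Real.rpow_le_one_add_pow (y := z / (a + k)) (by positivity) hβ hn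
    have h2 : (z / (a + k)) ^ n * (z ^ (2 * k) / (2 * k).factorial) ≤
        (2 + 2 * n) ^ n * (z ^ (2 * k + n) / (2 * k + n).factorial) := by
      have h3 := Nat.factorial_two_mul_add_le ha n k
      rw [div_pow, div_mul_div_comm, mul_div_assoc', div_le_div_iff₀ (by positivity)
        (by positivity)]
      calc _ ≤ z ^ n * z ^ (2 * k) * ((2 * k).factorial * ((2 + 2 * n) * (a + k)) ^ n) := by
            gcongr
        _ = _ := by rw [mul_pow, pow_add]; ring
    calc _ ≤ z ^ (a - 1 / 2) * ((a / (a + k)) ^ (a - 1 / 2) * (z ^ (2 * k) / (2 * k).factorial)) := by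
          gcongr
          exact div_besselDenom_le ha k
      _ = a ^ (a - 1 / 2) * ((z / (a + k)) ^ (a - 1 / 2) * (z ^ (2 * k) / (2 * k).factorial)) := by
          rw [Real.div_rpow ha0.le hak.le, Real.div_rpow hz.le hak.le]
          ring
      _ ≤ a ^ (a - 1 / 2) * ((1 + (z / (a + k)) ^ n) * (z ^ (2 * k) / (2 * k).factorial)) := by
          gcongr
      _ ≤ _ := by
          rw [add_mul, one_mul]
          gcongr
  rw [← tsum_mul_left]
  calc _ ≤ ∑' k : ℕ, a ^ (a - 1 / 2) * (z ^ (2 * k) / (2 * k).factorial +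
        (2 + 2 * n) ^ n * (z ^ (2 * k + n) / (2 * k + n).factorial)) :=
        ((summable_div_besselDenom ha z).mul_left _).tsum_le_tsum hterm
          ((hs0.add (hs.mul_left _)).mul_left _)
    _ = a ^ (a - 1 / 2) * (∑' k : ℕ, z ^ (2 * k) / (2 * k).factorial +
        (2 + 2 * n) ^ n * ∑' k : ℕ, z ^ (2 * k + n) / (2 * k + n).factorial) := by
        rw [tsum_mul_left, hs0.tsum_add (hs.mul_left _), tsum_mul_left]
    _ ≤ a ^ (a - 1 / 2) * (Real.exp z + (2 + 2 * n) ^ n * Real.exp z) := by gcongr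
    _ = _ := by ring

theorem norm_besselI_le {ν : ℂ} (hν : -(1 / 2) ≤ ν.re) {z : ℝ} (hz : 0 < z) :
    ‖besselI ν z‖ ≤ (z / 2) ^ ν.re / ‖Complex.Gamma (ν + 1)‖ *
      ∑' k : ℕ, (z / 2) ^ (2 * k) / besselDenom (ν.re + 1) k := by
  have hre : (ν + 1).re = ν.re + 1 := by simp
  have ha : 1 / 2 ≤ ν.re + 1 := by linarith
  have hΓ : 0 < ‖Complex.Gamma (ν + 1)‖ :=
    norm_pos_iff.2 (Complex.Gamma_ne_zero_of_re_pos (by rw [hre]; linarith))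
  refine tsum_of_norm_bounded ((summable_div_besselDenom ha z).hasSum.mul_left _) fun k => ?_
  have h := Complex.norm_Gamma_mul_prod_le (s := ν + 1) (by rw [hre]; linarith) k
  rw [hre] at h
  have hz2 : 0 < z / 2 := by positivity
  have e1 : ‖((z : ℂ) / 2) ^ (ν + 2 * (k : ℂ))‖ = (z / 2) ^ ν.re * (z / 2) ^ (2 * k) := by
    have : ((z : ℂ) / 2) = ((z / 2 : ℝ) : ℂ) := by push_cast; rfl
    rw [this, Complex.norm_cpow_eq_rpow_re_of_pos hz2, ← Real.rpow_natCast (z / 2),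
      ← Real.rpow_add hz2]
    simp
  have e2 : ν + k + 1 = ν + 1 + k := by ring
  have hD := besselDenom_pos (by linarith : 0 < ν.re + 1) k
  rw [norm_div, e1, norm_mul, Complex.norm_natCast, e2, div_mul_div_comm]
  refine div_le_div_of_nonneg_left (by rw [pow_mul]; positivity) (by positivity) ?_
  calc ‖Complex.Gamma (ν + 1)‖ * besselDenom (ν.re + 1) k =
      (k.factorial : ℝ) * (‖Complex.Gamma (ν + 1)‖ * ∏ j ∈ Finset.range k, (ν.re + 1 + j)) := by
        rw [besselDenom]; ring
    _ ≤ _ := by gcongr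

/-- Growth of `I` for small and for large arguments, uniformly in the imaginary part of the
order up to the factor `cosh (π τ)`. -/
theorem exists_norm_besselI_le {α : ℝ} (hα : -(1 / 2) < α) :
    ∃ C : ℝ, 0 ≤ C ∧ ∀ z : ℝ, 0 < z → ∀ τ : ℝ,
      ‖besselI (α - τ * Complex.I) z‖ ≤
        C * Real.cosh (Real.pi * τ) * Real.exp z * z ^ α ∧
      ‖besselI (α - τ * Complex.I) z‖ ≤
        C * Real.cosh (Real.pi * τ) * Real.exp z * z ^ (-(1 / 2) : ℝ) := by
  have ha : 1 / 2 ≤ α + 1 := by linarith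
  obtain ⟨M, hM, hΓ⟩ := exists_one_le_mul_cosh_mul_norm_Gamma (σ := α + 1) (by linarith)
  obtain ⟨L, hL, hS⟩ := exists_rpow_mul_tsum_le ha
  refine ⟨2 ^ (-α) * M * (1 + L), by positivity, fun z hz τ => ?_⟩
  have hc := Real.cosh_pos (Real.pi * τ)
  have hre : (α - τ * Complex.I : ℂ).re = α := by simp
  have hI := norm_besselI_le (ν := α - τ * Complex.I) (by rw [hre]; linarith) hz
  rw [hre] at hI
  have e : (α - τ * Complex.I + 1 : ℂ) = ((α + 1 : ℝ) : ℂ) + ((-τ : ℝ) : ℂ) * Complex.I := by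
    push_cast; ring
  have hG := hΓ (-τ)
  rw [mul_neg, Real.cosh_neg] at hG
  rw [e] at hI
  have hg : 0 < ‖Complex.Gamma (((α + 1 : ℝ) : ℂ) + ((-τ : ℝ) : ℂ) * Complex.I)‖ := by
    rcases (norm_nonneg (Complex.Gamma (((α + 1 : ℝ) : ℂ) + ((-τ : ℝ) : ℂ) * Complex.I))).lt_or_eq
      with h | h
    · exact h
    · rw [← h] at hG; norm_num at hG
  set g := ‖Complex.Gamma (((α + 1 : ℝ) : ℂ) + ((-τ : ℝ) : ℂ) * Complex.I)‖
  set S := ∑' k : ℕ, (z / 2) ^ (2 * k) / besselDenom (α + 1) k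
  have hS0 : 0 ≤ S := tsum_nonneg fun k => by
    have := besselDenom_pos (by linarith : 0 < α + 1) k
    positivity
  have hI' : ‖besselI (α - τ * Complex.I) z‖ ≤
      2 ^ (-α) * M * Real.cosh (Real.pi * τ) * (z ^ α * S) := by
    calc _ ≤ (z / 2) ^ α / g * S := hI
      _ ≤ (z / 2) ^ α * (M * Real.cosh (Real.pi * τ)) * S := by
          gcongr
          rw [div_le_iff₀ hg, mul_assoc]
          exact le_mul_of_one_le_right (by positivity) hG
      _ = _ := by
          rw [Real.div_rpow hz.le (by norm_num), Real.rpow_neg (by norm_num)]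
          ring
  have hS1 : S ≤ Real.exp z := tsum_div_besselDenom_le_exp ha hz.le
  have hS2 : z ^ α * S ≤ L * Real.exp z * z ^ (-(1 / 2) : ℝ) := by
    have e3 : z ^ α = z ^ (α + 1 - 1 / 2) * z ^ (-(1 / 2) : ℝ) := by
      rw [← Real.rpow_add hz]; congr 1; ring
    rw [e3, mul_right_comm]
    exact mul_le_mul_of_nonneg_right (hS z hz) (by positivity)
  have hK : 0 ≤ 2 ^ (-α) * M * Real.cosh (Real.pi * τ) := by positivity
  constructor
  · calc _ ≤ 2 ^ (-α) * M * Real.cosh (Real.pi * τ) * (z ^ α * Real.exp z) :=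
          hI'.trans (by gcongr)
      _ ≤ 2 ^ (-α) * M * Real.cosh (Real.pi * τ) * (z ^ α * Real.exp z) * (1 + L) :=
          le_mul_of_one_le_right (by positivity) (by linarith)
      _ = _ := by ring
  · calc _ ≤ 2 ^ (-α) * M * Real.cosh (Real.pi * τ) * (L * Real.exp z * z ^ (-(1 / 2) : ℝ)) :=
          hI'.trans (by gcongr)
      _ ≤ 2 ^ (-α) * M * Real.cosh (Real.pi * τ) *
          ((1 + L) * Real.exp z * z ^ (-(1 / 2) : ℝ)) := by
          gcongr
          linarith
      _ = _ := by ring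

/-- estimate (3.3): for `max(−α,0) < γ < 1/2` there is a
constant `C > 0`, independent of `x` and `τ`, with `|Φ_{α,τ}(x)| ≤ C x^{−γ}`. -/
theorem statement13 (α γ : ℝ) (hγ : max (-α) 0 < γ ∧ γ < 1/2) :
    ∃ C > 0, ∀ x : ℝ, 0 < x → ∀ τ : ℝ,
      |PhiKer α τ x| ≤ C * x ^ (-γ) := by
  obtain ⟨hmax, hγ2⟩ := hγ
  obtain ⟨h1, hγ0⟩ := max_lt_iff.1 hmax
  have hq : |α| < 2 * γ + α := by
    rw [abs_lt]; constructor <;> linarith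
  obtain ⟨A, hA, hK⟩ := exists_norm_besselK_le (α := α) hγ0 hγ2 hq
  obtain ⟨B, hB, hI⟩ := exists_norm_besselI_le (α := α) (by linarith)
  have hπ : 0 ≤ Real.sqrt Real.pi := Real.sqrt_nonneg _
  refine ⟨4 * Real.sqrt Real.pi * (A * B) + 1, by positivity, fun x hx τ => ?_⟩
  obtain ⟨z, hz, rfl⟩ : ∃ z : ℝ, 0 < z ∧ x = z ^ 2 :=
    ⟨Real.sqrt x, Real.sqrt_pos.2 hx, (Real.sq_sqrt hx.le).symm⟩
  have hc := Real.cosh_pos (Real.pi * τ)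
  set c := Real.cosh (Real.pi * τ) with hcdef
  have hpow : (z ^ 2) ^ (-γ) = z ^ (-(2 * γ)) := by
    rw [← Real.rpow_natCast z 2, ← Real.rpow_mul hz.le]; push_cast; congr 1; ring
  obtain ⟨hI1, hI2⟩ := hI z hz τ
  have hK' := hK z hz τ
  have hexp : Real.exp (-z) * Real.exp z = 1 := by rw [← Real.exp_add]; simp
  have hprod : ‖besselK (α + τ * Complex.I) z‖ * ‖besselI (α - τ * Complex.I) z‖ ≤
      2 * (A * B) * c * z ^ (-(2 * γ)) := by
    rcases le_total z 1 with h | h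
    · have hpq : z ^ (-γ) ≤ z ^ (-(2 * γ + α)) :=
        Real.rpow_le_rpow_of_exponent_ge hz h (by linarith)
      calc _ ≤ A * (Real.exp (-z) * (z ^ (-γ) + z ^ (-(2 * γ + α)))) *
            (B * c * Real.exp z * z ^ α) := by gcongr
        _ ≤ A * (Real.exp (-z) * (z ^ (-(2 * γ + α)) + z ^ (-(2 * γ + α)))) *
            (B * c * Real.exp z * z ^ α) := by gcongr
        _ = 2 * (A * B) * c * (z ^ (-(2 * γ + α)) * z ^ α) * (Real.exp (-z) * Real.exp z) := by
            ring
        _ = _ := by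
            rw [hexp, ← Real.rpow_add hz, mul_one]
            congr 2
            ring
    · have hpq : z ^ (-(2 * γ + α)) ≤ z ^ (-γ) :=
        Real.rpow_le_rpow_of_exponent_le h (by linarith)
      calc _ ≤ A * (Real.exp (-z) * (z ^ (-γ) + z ^ (-(2 * γ + α)))) *
            (B * c * Real.exp z * z ^ (-(1 / 2) : ℝ)) := by gcongr
        _ ≤ A * (Real.exp (-z) * (z ^ (-γ) + z ^ (-γ))) *
            (B * c * Real.exp z * z ^ (-(1 / 2) : ℝ)) := by gcongr
        _ = 2 * (A * B) * c * (z ^ (-γ) * z ^ (-(1 / 2) : ℝ)) *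
            (Real.exp (-z) * Real.exp z) := by ring
        _ = 2 * (A * B) * c * z ^ (-γ + -(1 / 2)) := by
            rw [hexp, ← Real.rpow_add hz, mul_one]
        _ ≤ _ := by
            gcongr ?_ * ?_
            exact Real.rpow_le_rpow_of_exponent_le h (by linarith)
  rw [PhiKer, Real.sqrt_sq hz.le, hpow, abs_mul, abs_of_nonneg (by positivity), ← hcdef]
  have hzp : 0 ≤ z ^ (-(2 * γ)) := by positivity
  calc _ ≤ 2 * Real.sqrt Real.pi / c * (2 * (A * B) * c * z ^ (-(2 * γ))) := by
        gcongr
        refine (Complex.abs_re_le_norm _).trans ?_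
        rw [norm_mul]
        exact hprod
    _ = 4 * Real.sqrt Real.pi * (A * B) * z ^ (-(2 * γ)) := by field_simp; ring
    _ ≤ _ := by linarith
end
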